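/- arXiv:2107.00446 — 2 statements merged into one kernel-verified Lean document; each statement's English description precedes it below -/
import Mathlib

section
/- There exists a constant c ≥ 1 such that for every straight-line program G of size g there is a straight-line program G' with the following properties: G' has size at most c·g, every right-hand side of G' has length at most c, G' is contracting with respect to the length weight (for every rule A → u of G' and every variable B occurring in u one has |val(B)| ≤ |val(A)|/2), and every string defined by G is also defined by G'. -/
/-- A straight-line program: every variable has exactly one rule `rhs A`,
and a ranking witnesses acyclicity (variables on right-hand sides have
smaller rank), so every variable derives a unique string `val A`. -/
structure SLP (V : Type) (Γ : Type) where
  rhs : V → List (V ⊕ Γ)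
  rank : V → ℕ
  rank_lt : ∀ A B, Sum.inl B ∈ rhs A → rank B < rank A
  start : V

namespace SLP

variable {V Γ : Type}

/-- The string derived by a variable. -/
def val (G : SLP V Γ) (A : V) : List Γ :=
  ((G.rhs A).attach.map (fun β =>
    match β with
    | ⟨Sum.inl B, _⟩ => G.val B
    | ⟨Sum.inr a, _⟩ => [a])).flatten
termination_by G.rank A
decreasing_by exact G.rank_lt _ _ (by assumption)

/-- A string is defined by the SLP if some variable derives it. -/
def defines (G : SLP V Γ) (s : List Γ) : Prop := ∃ A, G.val A = s

/-- The size of an SLP: total length of all right-hand sides. -/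
def size [Fintype V] (G : SLP V Γ) : ℕ := ∑ A : V, (G.rhs A).length

end SLP

/-- Weight of a string over a weighted alphabet. -/
def wstr {Γ : Type} (w : Γ → ℕ) (s : List Γ) : ℕ := (s.map w).sum

namespace SLP

variable {V Γ : Type}

/-- Weight of the string derived by a variable. -/
def wval (G : SLP V Γ) (w : Γ → ℕ) (A : V) : ℕ := wstr w (G.val A)

/-- Weight of a symbol (variable or terminal). -/
def symWeight (G : SLP V Γ) (w : Γ → ℕ) : V ⊕ Γ → ℕ
  | Sum.inl B => G.wval w B
  | Sum.inr a => w a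

/-- An SLP is contracting (w.r.t. the weight `w`) if every variable `B` on the
right-hand side of a rule of `A` satisfies `‖B‖ ≤ ‖A‖/2`. -/
def Contracting (G : SLP V Γ) (w : Γ → ℕ) : Prop :=
  ∀ A B, Sum.inl B ∈ G.rhs A → 2 * G.wval w B ≤ G.wval w A

end SLP


section Splits

variable {α : Type} {P Q : List α → Prop} {k k' : ℕ} {s t : List α} {w : α → ℕ}

@[simp] theorem wstr_nil (w : α → ℕ) : wstr w [] = 0 := rfl

@[simp] theorem wstr_append (w : α → ℕ) (s t : List α) :
    wstr w (s ++ t) = wstr w s + wstr w t := by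
  simp [wstr]

theorem wstr_one_eq_length (s : List α) : wstr (fun _ => 1) s = s.length := by
  simp [wstr]

theorem List.IsInfix.wstr_le (h : s <:+: t) (w : α → ℕ) : wstr w s ≤ wstr w t := by
  obtain ⟨a, b, rfl⟩ := h
  simp only [wstr_append]
  omega

theorem List.isInfix_flatten_of_mem {l : List (List α)} (h : s ∈ l) : s <:+: l.flatten := by
  obtain ⟨a, b, rfl⟩ := List.append_of_mem h
  exact ⟨a.flatten, b.flatten, by simp⟩

/-- `s` is a concatenation of at most `k` words satisfying `P`. -/
def Splits (P : List α → Prop) (k : ℕ) (s : List α) : Prop :=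
  ∃ l : List (List α), l.length ≤ k ∧ (∀ x ∈ l, P x) ∧ l.flatten = s

theorem Splits.nil : Splits P k [] := ⟨[], by simp⟩

theorem Splits.single (h : P s) : Splits P 1 s := ⟨[s], by simp [h]⟩

theorem Splits.append (hs : Splits P k s) (ht : Splits P k' t) : Splits P (k + k') (s ++ t) := by
  obtain ⟨l, hl, hP, rfl⟩ := hs
  obtain ⟨l', hl', hP', rfl⟩ := ht
  refine ⟨l ++ l', by simp; omega, ?_, by simp⟩
  intro x hx
  rcases List.mem_append.1 hx with h | h
  exacts [hP x h, hP' x h]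

theorem Splits.mono (hs : Splits P k s) (hk : k ≤ k') (h : ∀ x, P x → x <:+: s → Q x) :
    Splits Q k' s := by
  obtain ⟨l, hl, hP, rfl⟩ := hs
  exact ⟨l, hl.trans hk, fun x hx => h x (hP x hx) (List.isInfix_flatten_of_mem hx), rfl⟩

theorem Splits.bind (hs : Splits P k s) (h : ∀ x, P x → x <:+: s → Splits Q k' x) :
    Splits Q (k * k') s := by
  obtain ⟨l, hl, hP, rfl⟩ := hs
  have h' : ∀ x ∈ l, Splits Q k' x := fun x hx => h x (hP x hx) (List.isInfix_flatten_of_mem hx)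
  clear h hP
  suffices Splits Q (l.length * k') l.flatten from
    this.mono (Nat.mul_le_mul_right _ hl) fun _ hx _ => hx
  clear hl
  induction l with
  | nil => exact Splits.nil
  | cons a l ih =>
    have := (h' a (by simp)).append (ih fun x hx => h' x (by simp [hx]))
    simpa [Nat.succ_mul, Nat.add_comm] using this

/-- Every word in `F` is a concatenation of at most `k` words, each of which lies in `L` or is a
word in `F` of at most half the weight. -/
def ContractsOver (w : α → ℕ) (L : Set (List α)) (F : Finset (List α)) (k : ℕ) : Prop :=
  ∀ s ∈ F, Splits (fun x => x ∈ L ∨ x ∈ F ∧ 2 * wstr w x ≤ wstr w s) k s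

open Classical in
theorem ContractsOver.union {L L' : Set (List α)} {F E : Finset (List α)}
    (hF : ContractsOver w L' F k) (hE : ContractsOver w L E k') (hk : 1 ≤ k) (hk' : 1 ≤ k')
    (hL : ∀ x ∈ L', x ∈ L ∨ x ∈ E) : ContractsOver w L (F ∪ E) (k * k') := by
  intro s hs
  rcases Finset.mem_union.1 hs with hs | hs
  · refine (hF s hs).bind ?_
    rintro x (hx | ⟨hx, hxs⟩) hi
    · rcases hL x hx with hx | hx
      · exact (Splits.single (Or.inl hx)).mono hk' fun _ h _ => h
      · refine (hE x hx).mono le_rfl ?_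
        rintro y (hy | ⟨hy, hyx⟩) -
        · exact Or.inl hy
        · exact Or.inr ⟨Finset.mem_union_right _ hy, hyx.trans (hi.wstr_le w)⟩
    · exact (Splits.single (Or.inr ⟨Finset.mem_union_left _ hx, hxs⟩)).mono hk' fun _ h _ => h
  · refine (hE s hs).mono (Nat.le_mul_of_pos_left _ hk) ?_
    rintro y (hy | ⟨hy, hyx⟩) -
    · exact Or.inl hy
    · exact Or.inr ⟨Finset.mem_union_right _ hy, hyx⟩

theorem ContractsOver.biUnion [DecidableEq (List α)] {ι : Type} {L : Set (List α)} (I : Finset ι)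
    (F : ι → Finset (List α))
    (hF : ∀ i ∈ I, ContractsOver w L (F i) k) : ContractsOver w L (I.biUnion F) k := by
  intro s hs
  obtain ⟨i, hi, hs⟩ := Finset.mem_biUnion.1 hs
  refine (hF i hi s hs).mono le_rfl ?_
  rintro x (hx | ⟨hx, hxs⟩) -
  · exact Or.inl hx
  · exact Or.inr ⟨Finset.mem_biUnion.2 ⟨i, hi, hx⟩, hxs⟩

end Splits

section Median

variable {α : Type}

theorem exists_median (w : α → ℕ) (l : List (List α)) (hl : l ≠ []) :
    ∃ x c y, l = x ++ c :: y ∧ 2 * wstr w x.flatten ≤ wstr w l.flatten ∧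
      2 * wstr w y.flatten ≤ wstr w l.flatten := by
  suffices ∀ (l x : List (List α)), l ≠ [] → ∀ m, m = wstr w (x ++ l).flatten →
      2 * wstr w x.flatten ≤ m → ∃ x' c y, x ++ l = x' ++ c :: y ∧
      2 * wstr w x'.flatten ≤ m ∧ 2 * wstr w y.flatten ≤ m by
    simpa using this l [] hl _ rfl (by simp)
  intro l
  induction l with
  | nil => simp
  | cons a l ih =>
    intro x _ m hm hx
    by_cases h : 2 * wstr w (x ++ [a]).flatten ≤ m ∧ l ≠ []
    · obtain ⟨x', c, y, h1, h2⟩ := ih (x ++ [a]) h.2 m (by simpa using hm) h.1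
      exact ⟨x', c, y, by simpa using h1, h2⟩
    · refine ⟨x, a, l, rfl, hx, ?_⟩
      by_cases hl : l = []
      · simp [hl]
      · have : ¬ 2 * wstr w (x ++ [a]).flatten ≤ m := fun h' => h ⟨h', hl⟩
        simp at this hm
        omega

open Classical in
theorem exists_contractsOver_flatten (w : α → ℕ) (l : List (List α)) :
    ∃ F : Finset (List α), F.card ≤ 2 * l.length + 1 ∧ l.flatten ∈ F ∧
      ContractsOver w {x | x ∈ l} F 3 := by
  induction hn : l.length using Nat.strong_induction_on generalizing l with
  | _ n ih =>
    by_cases hl : l = []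
    · refine ⟨{[]}, by simp, by simp [hl], ?_⟩
      intro s hs
      rw [Finset.mem_singleton.1 hs]
      exact Splits.nil
    · obtain ⟨x, c, y, rfl, hx, hy⟩ := exists_median w l hl
      simp only [List.length_append, List.length_cons] at hn
      obtain ⟨F, hFc, hF, hFs⟩ := ih x.length (by omega) x rfl
      obtain ⟨E, hEc, hE, hEs⟩ := ih y.length (by omega) y rfl
      refine ⟨insert (x ++ c :: y).flatten (F ∪ E), ?_, by simp, ?_⟩
      · have := Finset.card_insert_le (x ++ c :: y).flatten (F ∪ E)
        have := Finset.card_union_le F E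
        omega
      · intro s hs
        rcases Finset.mem_insert.1 hs with rfl | hs
        · refine ⟨[x.flatten, c, y.flatten], by simp, ?_, by simp⟩
          simp only [List.mem_cons, List.not_mem_nil, or_false]
          rintro z (rfl | rfl | rfl)
          · exact Or.inr ⟨by simp [hF], hx⟩
          · exact Or.inl (by simp)
          · exact Or.inr ⟨by simp [hE], hy⟩
        · rcases Finset.mem_union.1 hs with hs | hs
          · refine (hFs s hs).mono le_rfl ?_
            rintro z (hz | ⟨hz, hzs⟩) -
            · exact Or.inl (by simp at hz; simp [hz])
            · exact Or.inr ⟨by simp [hz], hzs⟩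
          · refine (hEs s hs).mono le_rfl ?_
            rintro z (hz | ⟨hz, hzs⟩) -
            · exact Or.inl (by simp at hz; simp [hz])
            · exact Or.inr ⟨by simp [hz], hzs⟩

end Median

section Forest

variable {α : Type}

/-- Append the word `c` to a stack of words, merging the longest suffix of the stack whose first
word would no longer have the same binary length of weight as the whole suffix. -/
def pushMerge (w : α → ℕ) : List (List α) → List α → List (List α)
  | [], c => [c]
  | b :: r, c =>
    if (wstr w (b ++ r.flatten ++ c)).size = (wstr w b).size then b :: pushMerge w r c
    else [b ++ r.flatten ++ c]

/-- In every suffix of the stack, the first word has the same binary length of weight as the whole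
suffix. -/
def Dominated (w : α → ℕ) : List (List α) → Prop
  | [] => True
  | b :: r => (wstr w (b ++ r.flatten)).size = (wstr w b).size ∧ Dominated w r

theorem flatten_pushMerge (w : α → ℕ) (st : List (List α)) (c : List α) :
    (pushMerge w st c).flatten = st.flatten ++ c := by
  induction st with
  | nil => simp [pushMerge]
  | cons b r ih =>
    rw [pushMerge]
    split_ifs
    · simp [ih]
    · simp

theorem drop_pushMerge (w : α → ℕ) (st : List (List α)) (c : List α) (j : ℕ) :
    (pushMerge w st c).drop j = [] ∨
      ((pushMerge w st c).drop j).flatten = (st.drop j).flatten ++ c := by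
  induction st generalizing j with
  | nil => cases j <;> simp [pushMerge]
  | cons b r ih =>
    cases j with
    | zero => exact Or.inr (by simpa using flatten_pushMerge w (b :: r) c)
    | succ j =>
      rw [pushMerge]
      split_ifs
      · simpa using ih j
      · simp

theorem Dominated.pushMerge {w : α → ℕ} {st : List (List α)} (h : Dominated w st) (c : List α) :
    Dominated w (pushMerge w st c) := by
  induction st with
  | nil => simp [_root_.pushMerge, Dominated]
  | cons b r ih =>
    rw [_root_.pushMerge]
    split_ifs with hb
    · refine ⟨?_, ih h.2⟩
      rw [flatten_pushMerge, ← List.append_assoc]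
      exact hb
    · simp [Dominated]

theorem Dominated.drop {w : α → ℕ} {st : List (List α)} (h : Dominated w st) (i : ℕ) :
    Dominated w (st.drop i) := by
  induction st generalizing i with
  | nil => simpa using h
  | cons b r ih =>
    cases i with
    | zero => simpa using h
    | succ i => simpa using ih h.2 i

theorem getElem?_pushMerge {w : α → ℕ} {st : List (List α)} (h : Dominated w st) (c b : List α)
    (i : ℕ) (hb : (pushMerge w st c)[i]? = some b) :
    st[i]? = some b ∨ b = (st.drop i).flatten ++ c ∧
      ((st.drop i).flatten = [] ∨ (wstr w (st.drop i).flatten).size < (wstr w b).size) := by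
  induction st generalizing i with
  | nil =>
    cases i with
    | zero => simp [pushMerge] at hb; simp [hb]
    | succ i => simp [pushMerge] at hb
  | cons a r ih =>
    rw [pushMerge] at hb
    split_ifs at hb with hab
    · cases i with
      | zero => exact Or.inl (by simpa using hb)
      | succ i => simpa using ih h.2 i (by simpa using hb)
    · cases i with
      | succ i => simp at hb
      | zero =>
        simp only [List.getElem?_cons_zero, Option.some.injEq] at hb
        refine Or.inr ⟨by simp [← hb], Or.inr ?_⟩
        rw [← hb]
        refine lt_of_le_of_ne (Nat.size_le_size (by simp)) ?_
        intro he
        apply hab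
        rw [← he]
        exact h.1

variable {N : Type} (w : α → ℕ) (p : N → Option N) (c : N → List α)

/-- The stack obtained by pushing the labels on the path from the root to `v`. -/
def pathStack (d : N → ℕ) (hd : ∀ v u, p v = some u → d u < d v) (v : N) : List (List α) :=
  pushMerge w (match _hp : p v with
    | none => []
    | some u => pathStack d hd u) (c v)
termination_by d v
decreasing_by exact hd _ _ _hp

variable (d : N → ℕ) (hd : ∀ v u, p v = some u → d u < d v)

/-- The stack before the label of `v` is pushed. -/
def parentStack (v : N) : List (List α) := (p v).elim [] (pathStack w p c d hd)

theorem pathStack_eq (v : N) :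
    pathStack w p c d hd v = pushMerge w (parentStack w p c d hd v) (c v) := by
  rw [pathStack, parentStack]
  congr 1
  split <;> rename_i h <;> simp [h]

theorem dominated_pathStack (v : N) : Dominated w (pathStack w p c d hd v) := by
  induction hn : d v using Nat.strong_induction_on generalizing v with
  | _ n ih =>
    rw [pathStack_eq]
    apply Dominated.pushMerge
    rw [parentStack]
    cases hp : p v with
    | none => trivial
    | some u => exact ih (d u) (hn ▸ hd _ _ hp) u rfl

theorem dominated_parentStack (v : N) : Dominated w (parentStack w p c d hd v) := by
  rw [parentStack]
  cases p v with
  | none => trivial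
  | some u => exact dominated_pathStack w p c d hd u

theorem exists_of_getElem?_pathStack (h : N → ℕ) (hh : ∀ v u, p v = some u → h v < h u) (v : N)
    (i : ℕ) (b : List α) (hb : (pathStack w p c d hd v)[i]? = some b) :
    ∃ x, h v ≤ h x ∧ b = ((parentStack w p c d hd x).drop i).flatten ++ c x ∧
      (((parentStack w p c d hd x).drop i).flatten = [] ∨
        (wstr w ((parentStack w p c d hd x).drop i).flatten).size < (wstr w b).size) := by
  induction hn : d v using Nat.strong_induction_on generalizing v with
  | _ n ih =>
    rw [pathStack_eq] at hb
    rcases getElem?_pushMerge (dominated_parentStack w p c d hd v) _ _ _ hb with hb | ⟨h1, h2⟩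
    · cases hp : p v with
      | none => simp [parentStack, hp] at hb
      | some u =>
        obtain ⟨x, hx, hx'⟩ := ih (d u) (hn ▸ hd _ _ hp) u (by simpa [parentStack, hp] using hb) rfl
        exact ⟨x, (hh _ _ hp).le.trans hx, hx'⟩
    · exact ⟨v, le_rfl, h1, h2⟩

theorem two_mul_le_of_size_lt {a b : ℕ} (h : a.size + 1 < b.size) : 2 * a ≤ b := by
  have h1 := Nat.lt_size_self a
  have h2 := Nat.lt_size.1 (show a.size + 1 < b.size from h)
  rw [pow_succ] at h2
  omega

theorem two_mul_le_of_size_eq {a b : ℕ} (h : (a + b).size = a.size) : 2 * b ≤ a + b := by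
  by_contra! hlt
  have h1 := Nat.lt_size_self (a + b)
  rw [h] at h1
  cases hs : a.size with
  | zero => rw [hs] at h1; simp at h1; omega
  | succ n =>
    have := Nat.lt_size.1 (show n < a.size by omega)
    rw [hs, pow_succ] at h1
    omega

/-- A suffix of a path word, as left over after the first `i` words of its stack. -/
def stackSuffix (i : ℕ) (v : N) : List α := ((pathStack w p c d hd v).drop i).flatten

theorem stackSuffix_zero (v : N) :
    stackSuffix w p c d hd 0 v = (p v).elim [] (stackSuffix w p c d hd 0) ++ c v := by
  simp only [stackSuffix, List.drop_zero]
  rw [pathStack_eq, flatten_pushMerge, parentStack]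
  cases p v <;> simp [stackSuffix]

theorem stackSuffix_eq_nil_or (i : ℕ) (v : N) : stackSuffix w p c d hd i v = [] ∨
    stackSuffix w p c d hd i v = (p v).elim [] (stackSuffix w p c d hd i) ++ c v := by
  have := drop_pushMerge w (parentStack w p c d hd v) (c v) i
  rw [← pathStack_eq] at this
  refine this.imp (fun h => by simp [stackSuffix, h]) fun h => ?_
  rw [stackSuffix, h, parentStack]
  cases p v <;> simp [stackSuffix]

theorem stackSuffix_decomp (h : N → ℕ) (hh : ∀ v u, p v = some u → h v < h u) (i : ℕ) (v : N) :
    stackSuffix w p c d hd i v = [] ∨ ∃ x, h v ≤ h x ∧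
      stackSuffix w p c d hd i v =
        (p x).elim [] (stackSuffix w p c d hd i) ++ c x ++ stackSuffix w p c d hd (i + 1) v ∧
      ((p x).elim [] (stackSuffix w p c d hd i) = [] ∨
        (wstr w ((p x).elim [] (stackSuffix w p c d hd i))).size <
          (wstr w (stackSuffix w p c d hd i v)).size) ∧
      2 * wstr w (stackSuffix w p c d hd (i + 1) v) ≤ wstr w (stackSuffix w p c d hd i v) := by
  by_cases hi : i < (pathStack w p c d hd v).length
  · right
    have hdrop := List.drop_eq_getElem_cons hi
    obtain ⟨x, hx, hb, hlt⟩ := exists_of_getElem?_pathStack w p c d hd h hh v i _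
      (List.getElem?_eq_getElem hi)
    have hpar : ((parentStack w p c d hd x).drop i).flatten =
        (p x).elim [] (stackSuffix w p c d hd i) := by
      rw [parentStack]
      cases p x <;> simp [stackSuffix]
    rw [hpar] at hb hlt
    have hdom := (dominated_pathStack w p c d hd v).drop i
    have heq : stackSuffix w p c d hd i v =
        (pathStack w p c d hd v)[i] ++ stackSuffix w p c d hd (i + 1) v := by
      rw [stackSuffix, hdrop, List.flatten_cons, stackSuffix]
    rw [hdrop] at hdom
    have hdom := hdom.1
    rw [← stackSuffix, wstr_append] at hdom
    refine ⟨x, hx, by rw [heq, hb], ?_, ?_⟩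
    · rw [heq, wstr_append, hdom]
      exact hlt
    · rw [heq, wstr_append]
      exact two_mul_le_of_size_eq hdom
  · left
    rw [stackSuffix, List.drop_eq_nil_of_le (by omega)]
    rfl

open Classical in
/-- In a forest whose parent map strictly increases the height `h`, the path words can be obtained
from a contracting family over the labels whose size is bounded by the sum of the heights. -/
theorem exists_contractsOver_forest {N : Type} [Fintype N] (w : α → ℕ) (p : N → Option N)
    (c : N → List α) (d : N → ℕ) (hd : ∀ v u, p v = some u → d u < d v) (h : N → ℕ)
    (hh : ∀ v u, p v = some u → h v < h u) (word : N → List α)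
    (hword : ∀ v, word v = (p v).elim [] word ++ c v) :
    ∃ F : Finset (List α), F.card ≤ ∑ v, (h v + 1) ∧ (∀ v, word v ∈ F) ∧
      ContractsOver w (Set.range c) F 6 := by
  set f := stackSuffix w p c d hd with hf
  have hmem : ∀ i v, i ≤ h v → f i v ∈
      Finset.univ.biUnion fun v => (Finset.range (h v + 1)).image fun i => f i v := by
    intro i v hi
    simp only [Finset.mem_biUnion, Finset.mem_univ, true_and, Finset.mem_image, Finset.mem_range]
    exact ⟨v, i, by omega, rfl⟩
  refine ⟨Finset.univ.biUnion fun v => (Finset.range (h v + 1)).image fun i => f i v, ?_, ?_, ?_⟩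
  · refine Finset.card_biUnion_le.trans (Finset.sum_le_sum fun v _ => ?_)
    exact Finset.card_image_le.trans (by simp)
  · intro v
    suffices word v = f 0 v by
      rw [this]
      exact hmem 0 v (Nat.zero_le _)
    induction hn : d v using Nat.strong_induction_on generalizing v with
    | _ n ih =>
      rw [hword, hf, stackSuffix_zero]
      congr 1
      cases hp : p v with
      | none => rfl
      | some u => exact ih (d u) (hn ▸ hd _ _ hp) u rfl
  · intro s hs
    simp only [Finset.mem_biUnion, Finset.mem_univ, true_and, Finset.mem_image,
      Finset.mem_range] at hs
    obtain ⟨v, i, hi, rfl⟩ := hs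
    generalize (Finset.univ.biUnion fun v => (Finset.range (h v + 1)).image fun i => f i v) = F
      at hmem ⊢
    rcases stackSuffix_decomp w p c d hd h hh i v with h0 | ⟨x, hx, heq, hlt, hrest⟩
    · rw [← hf] at h0
      rw [h0]
      exact Splits.nil
    rw [← hf] at heq hlt hrest
    set P : List α → Prop := fun y => y ∈ Set.range c ∨ y ∈ F ∧ 2 * wstr w y ≤ wstr w (f i v)
    have hsuf : Splits P 2 (f (i + 1) v) := by
      rcases stackSuffix_eq_nil_or w p c d hd (i + 1) v with h0 | h0
      · rw [← hf] at h0
        rw [h0]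
        exact Splits.nil
      · rw [← hf] at h0
        rw [h0] at hrest ⊢
        refine Splits.append (k := 1) (k' := 1) ?_ (Splits.single (Or.inl ⟨v, rfl⟩))
        cases hp : p v with
        | none => exact Splits.nil
        | some u =>
          have := hh _ _ hp
          refine Splits.single (Or.inr ⟨hmem _ _ (by omega), ?_⟩)
          simp only [hp, Option.elim_some, wstr_append] at hrest ⊢
          omega
    have hpre : Splits P 3 ((p x).elim [] (f i)) := by
      cases hp : p x with
      | none => exact Splits.nil
      | some u =>
        have hxu := hh _ _ hp
        simp only [hp, Option.elim_some] at hlt heq ⊢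
        have hle : wstr w (f i u) ≤ wstr w (f i v) := by
          rw [heq, wstr_append, wstr_append]
          omega
        rcases stackSuffix_decomp w p c d hd h hh i u with h0 | ⟨y, hy, heq', hlt', hrest'⟩
        · rw [← hf] at h0
          rw [h0]
          exact Splits.nil
        rw [← hf] at heq' hlt' hrest'
        have h3 : Splits P 1 (f (i + 1) u) :=
          Splits.single (Or.inr ⟨hmem _ _ (by omega), hrest'.trans hle⟩)
        have h1 : Splits P 1 ((p y).elim [] (f i)) := by
          rcases hlt' with h0 | hlt'
          · rw [h0]
            exact Splits.nil
          cases hpy : p y with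
          | none => exact Splits.nil
          | some z =>
            have hyz := hh _ _ hpy
            simp only [hpy, Option.elim_some] at hlt' ⊢
            rcases hlt with h0 | hlt
            · simp [h0] at hlt'
            · exact Splits.single (Or.inr ⟨hmem _ _ (by omega),
                two_mul_le_of_size_lt (by omega)⟩)
        rw [heq']
        exact (h1.append (Splits.single (Or.inl ⟨y, rfl⟩))).append h3
    rw [heq]
    exact (hpre.append (Splits.single (Or.inl ⟨x, rfl⟩))).append hsuf

end Forest

section Prefixes

variable {α : Type}

/-- The `i`-th aligned block of length `2 ^ h` of the word `s`. -/
def dyadicBlock (s : List α) (h i : ℕ) : List α := (s.drop (i * 2 ^ h)).take (2 ^ h)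

theorem dyadicBlock_succ (s : List α) (h i : ℕ) :
    dyadicBlock s (h + 1) i = dyadicBlock s h (2 * i) ++ dyadicBlock s h (2 * i + 1) := by
  have h1 : i * 2 ^ (h + 1) = 2 * i * 2 ^ h := by ring
  have h2 : (2 * i + 1) * 2 ^ h = 2 * i * 2 ^ h + 2 ^ h := by ring
  rw [dyadicBlock, dyadicBlock, dyadicBlock, h1, h2, pow_succ, mul_two, List.take_add,
    List.drop_drop]

/-- Descending into heavy halves, a block decomposes into at most two contracted words in the middle
surrounded by at most `h` smaller blocks on either side. -/
theorem dyadicBlock_decomp (w : α → ℕ) (s : List α) (H m : ℕ) (P : List α → Prop)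
    (hP : ∀ h ≤ H, ∀ i < 2 ^ (H - h), P (dyadicBlock s h i)) (h i : ℕ) (hh : h ≤ H)
    (hi : i < 2 ^ (H - h)) (hm : m ≤ 2 * wstr w (dyadicBlock s h i)) :
    ∃ x z y : List (List α), x.length ≤ h ∧ y.length ≤ h ∧ z.length ≤ 2 ∧
      (∀ b ∈ x, P b) ∧ (∀ b ∈ y, P b) ∧
      (∀ b ∈ z, b.length ≤ 1 ∨ P b ∧ 2 * wstr w b ≤ m) ∧ m ≤ 2 * wstr w z.flatten ∧
      dyadicBlock s h i = x.flatten ++ z.flatten ++ y.flatten := by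
  induction h generalizing i with
  | zero =>
    refine ⟨[], [dyadicBlock s 0 i], [], by simp, by simp, by simp, by simp, by simp, ?_,
      by simpa using hm, by simp⟩
    intro b hb
    rw [List.mem_singleton.1 hb]
    exact Or.inl (by simp [dyadicBlock])
  | succ h ih =>
    have hpow : 2 ^ (H - h) = 2 * 2 ^ (H - (h + 1)) := by
      rw [← pow_succ']
      congr 1
      omega
    have h0 : P (dyadicBlock s h (2 * i)) := hP h (by omega) _ (by omega)
    have h1 : P (dyadicBlock s h (2 * i + 1)) := hP h (by omega) _ (by omega)
    rw [dyadicBlock_succ] at hm ⊢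
    by_cases hl : m ≤ 2 * wstr w (dyadicBlock s h (2 * i))
    · obtain ⟨x, z, y, hx, hy, hz, hPx, hPy, hPz, hmz, heq⟩ := ih (2 * i) (by omega) (by omega) hl
      refine ⟨x, z, y ++ [dyadicBlock s h (2 * i + 1)], by omega, by simp; omega, hz, hPx, ?_, hPz,
        hmz, by simp [heq]⟩
      simpa [or_imp, forall_and, h1] using hPy
    by_cases hr : m ≤ 2 * wstr w (dyadicBlock s h (2 * i + 1))
    · obtain ⟨x, z, y, hx, hy, hz, hPx, hPy, hPz, hmz, heq⟩ :=
        ih (2 * i + 1) (by omega) (by omega) hr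
      refine ⟨dyadicBlock s h (2 * i) :: x, z, y, by simp; omega, by omega, hz, ?_, hPy, hPz,
        hmz, by simp [heq]⟩
      simpa [or_imp, forall_and, h0] using hPx
    · refine ⟨[], [dyadicBlock s h (2 * i), dyadicBlock s h (2 * i + 1)], [], by simp, by simp,
        by simp, by simp, by simp, ?_, by simpa using hm, by simp⟩
      simp only [List.mem_cons, List.not_mem_nil, or_false]
      rintro b (rfl | rfl)
      · exact Or.inr ⟨h0, by omega⟩
      · exact Or.inr ⟨h1, by omega⟩

theorem sum_two_pow_sub_mul_le (H : ℕ) :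
    ∑ h ∈ Finset.range (H + 1), 2 ^ (H - h) * (4 * h + 3) ≤ 14 * 2 ^ H := by
  suffices ∑ h ∈ Finset.range (H + 1), 2 ^ (H - h) * (4 * h + 3) + 4 * H + 11 = 14 * 2 ^ H by
    omega
  induction H with
  | zero => simp
  | succ H ih =>
    rw [Finset.sum_range_succ]
    have : ∑ h ∈ Finset.range (H + 1), 2 ^ (H + 1 - h) * (4 * h + 3) =
        2 * ∑ h ∈ Finset.range (H + 1), 2 ^ (H - h) * (4 * h + 3) := by
      rw [Finset.mul_sum]
      refine Finset.sum_congr rfl fun h hh => ?_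
      have := Finset.mem_range.1 hh
      rw [show H + 1 - h = (H - h) + 1 by omega, pow_succ]
      ring
    rw [this, pow_succ]
    simp only [Nat.sub_self, pow_zero]
    omega

open Classical in
theorem exists_contractsOver_dyadicBlock (w : α → ℕ) (s : List α) (H : ℕ) :
    ∃ F : Finset (List α), F.card ≤ 14 * 2 ^ H ∧
      (∀ h ≤ H, ∀ i < 2 ^ (H - h), dyadicBlock s h i ∈ F) ∧
      ContractsOver w {x | x.length ≤ 1} F 12 := by
  set B : Finset (List α) := (Finset.range (H + 1)).biUnion fun h =>
    (Finset.range (2 ^ (H - h))).image fun i => dyadicBlock s h i with hB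
  have hBmem : ∀ h ≤ H, ∀ i < 2 ^ (H - h), dyadicBlock s h i ∈ B := by
    intro h hh i hi
    simp only [hB, Finset.mem_biUnion, Finset.mem_range, Finset.mem_image]
    exact ⟨h, by omega, i, hi, rfl⟩
  have key : ∀ h i, ∃ F : Finset (List α), F.card ≤ 4 * h + 3 ∧ dyadicBlock s h i ∈ F ∧
      (h ≤ H → i < 2 ^ (H - h) → ∀ G : Finset (List α), F ⊆ G → B ⊆ G →
        Splits (fun x => x ∈ {x : List α | x.length ≤ 1} ∨
          x ∈ G ∧ 2 * wstr w x ≤ wstr w (dyadicBlock s h i)) 4 (dyadicBlock s h i) ∧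
        ∀ t ∈ F, t = dyadicBlock s h i ∨
          Splits (fun x => x ∈ B ∨ x ∈ G ∧ 2 * wstr w x ≤ wstr w t) 3 t) := by
    intro h i
    by_cases hhi : h ≤ H ∧ i < 2 ^ (H - h)
    · obtain ⟨hh, hi⟩ := hhi
      obtain ⟨x, z, y, hx, hy, hz, hPx, hPy, hPz, hmz, heq⟩ :=
        dyadicBlock_decomp w s H (wstr w (dyadicBlock s h i)) (· ∈ B) hBmem h i hh hi (by omega)
      obtain ⟨X, hXc, hX, hXs⟩ := exists_contractsOver_flatten w x
      obtain ⟨Y, hYc, hY, hYs⟩ := exists_contractsOver_flatten w y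
      refine ⟨insert (dyadicBlock s h i) (X ∪ Y), ?_, by simp, ?_⟩
      · have := Finset.card_insert_le (dyadicBlock s h i) (X ∪ Y)
        have := Finset.card_union_le X Y
        omega
      · intro _ _ G hFG hBG
        have hXG : X ⊆ G := fun a ha => hFG (by simp [ha])
        have hYG : Y ⊆ G := fun a ha => hFG (by simp [ha])
        refine ⟨?_, fun t ht => (Finset.mem_insert.1 ht).imp id fun ht => ?_⟩
        · have hw := congrArg (wstr w) heq
          simp only [wstr_append] at hw
          set m := wstr w (dyadicBlock s h i)
          rw [heq]
          refine ((Splits.single (Or.inr ⟨hXG hX, by omega⟩)).append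
            (⟨z, hz, ?_, rfl⟩ : Splits _ 2 _)).append
            (Splits.single (Or.inr ⟨hYG hY, by omega⟩))
          exact fun b hb => (hPz b hb).imp id fun hb => ⟨hBG hb.1, hb.2⟩
        · rcases Finset.mem_union.1 ht with ht | ht
          · refine (hXs t ht).mono le_rfl ?_
            rintro b (hb | ⟨hb, hbt⟩) -
            exacts [Or.inl (hPx b hb), Or.inr ⟨hXG hb, hbt⟩]
          · refine (hYs t ht).mono le_rfl ?_
            rintro b (hb | ⟨hb, hbt⟩) -
            exacts [Or.inl (hPy b hb), Or.inr ⟨hYG hb, hbt⟩]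
    · exact ⟨{dyadicBlock s h i}, by simp, by simp, fun h1 h2 => absurd ⟨h1, h2⟩ hhi⟩
  choose F hFc hF hFs using key
  set G : Finset (List α) := (Finset.range (H + 1)).biUnion fun h =>
    (Finset.range (2 ^ (H - h))).biUnion fun i => F h i with hG
  have hGmem : ∀ h ≤ H, ∀ i < 2 ^ (H - h), F h i ⊆ G := by
    intro h hh i hi a ha
    simp only [hG, Finset.mem_biUnion, Finset.mem_range]
    exact ⟨h, by omega, i, hi, ha⟩
  have hBG : B ⊆ G := by
    intro a ha
    simp only [hB, Finset.mem_biUnion, Finset.mem_range, Finset.mem_image] at ha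
    obtain ⟨h, hh, i, hi, rfl⟩ := ha
    exact hGmem h (by omega) i hi (hF h i)
  have hblock : ∀ b ∈ B,
      Splits (fun x => x ∈ {x : List α | x.length ≤ 1} ∨ x ∈ G ∧ 2 * wstr w x ≤ wstr w b) 4 b := by
    intro b hb
    simp only [hB, Finset.mem_biUnion, Finset.mem_range, Finset.mem_image] at hb
    obtain ⟨h, hh, i, hi, rfl⟩ := hb
    exact (hFs h i (by omega) hi G (hGmem h (by omega) i hi) hBG).1
  refine ⟨G, ?_, fun h hh i hi => hGmem h hh i hi (hF h i), ?_⟩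
  · refine le_trans ?_ (sum_two_pow_sub_mul_le H)
    refine Finset.card_biUnion_le.trans (Finset.sum_le_sum fun h _ => ?_)
    refine Finset.card_biUnion_le.trans ((Finset.sum_le_card_nsmul _ _ _ fun i _ => hFc h i).trans ?_)
    simp
  · intro t ht
    simp only [hG, Finset.mem_biUnion, Finset.mem_range] at ht
    obtain ⟨h, hh, i, hi, ht⟩ := ht
    have hh : h ≤ H := by omega
    rcases (hFs h i hh hi G (hGmem h hh i hi) hBG).2 t ht with rfl | h1
    · exact (hFs h i hh hi G (hGmem h hh i hi) hBG).1.mono (by omega) fun _ hx _ => hx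
    · refine h1.bind (k' := 4) ?_
      rintro x (hx | hx) hi
      · refine (hblock x hx).mono le_rfl ?_
        rintro y (hy | ⟨hy, hyx⟩) -
        exacts [Or.inl hy, Or.inr ⟨hy, hyx.trans (hi.wstr_le w)⟩]
      · exact (Splits.single (Or.inr hx)).mono (by omega) fun _ h _ => h

theorem sum_padicValNat_succ_le (n : ℕ) :
    ∑ v : Fin n, (padicValNat 2 (v + 1) + 1) ≤ 2 * n := by
  have hfac : ∀ n : ℕ, ∑ v ∈ Finset.range n, padicValNat 2 (v + 1) = padicValNat 2 n.factorial := by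
    intro n
    induction n with
    | zero => simp
    | succ n ih =>
      rw [Finset.sum_range_succ, ih, Nat.factorial_succ,
        padicValNat.mul (by omega) (Nat.factorial_ne_zero n), add_comm]
  have h1 := sub_one_mul_padicValNat_factorial (p := 2) n
  rw [Finset.sum_add_distrib, Fin.sum_univ_eq_sum_range fun v => padicValNat 2 (v + 1), hfac]
  simp at h1 ⊢
  omega

open Classical in
theorem exists_contractsOver_prefixes (w : α → ℕ) (s : List α) (hs : s ≠ []) :
    ∃ F : Finset (List α), F.card ≤ 30 * s.length ∧ (∀ k < s.length, s.take (k + 1) ∈ F) ∧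
      ContractsOver w {x | x.length ≤ 1} F 72 := by
  set n := s.length with hn
  have hn0 : n ≠ 0 := by simpa [hn] using hs
  obtain ⟨H, hH1, hH2⟩ : ∃ H, n ≤ 2 ^ H ∧ 2 ^ H ≤ 2 * n := by
    refine ⟨Nat.log 2 n + 1, (Nat.lt_pow_succ_log_self one_lt_two n).le, ?_⟩
    have := Nat.pow_log_le_self 2 hn0
    rw [pow_succ]
    omega
  obtain ⟨B, hBc, hB, hBs⟩ := exists_contractsOver_dyadicBlock w s H
  have hdecomp : ∀ v : ℕ, ∃ q, v + 1 = 2 ^ padicValNat 2 (v + 1) * (2 * q + 1) := by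
    intro v
    obtain ⟨q, hq⟩ := pow_padicValNat_dvd (p := 2) (n := v + 1)
    have hodd : ¬ 2 ∣ q := by
      rintro ⟨r, rfl⟩
      refine pow_succ_padicValNat_not_dvd (p := 2) (n := v + 1) (by omega) ⟨r, ?_⟩
      rw [pow_succ]
      linarith
    exact ⟨q / 2, by rw [show 2 * (q / 2) + 1 = q by omega]; exact hq⟩
  choose q hq using hdecomp
  have hpos : ∀ v : ℕ, 0 < 2 ^ padicValNat 2 (v + 1) := fun v => by positivity
  have hsplit : ∀ v : ℕ, v + 1 = 2 * q v * 2 ^ padicValNat 2 (v + 1) + 2 ^ padicValNat 2 (v + 1) :=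
    fun v => by linarith [hq v]
  let par : Fin n → Option (Fin n) := fun v =>
    if h : q v = 0 then none else
      some ⟨2 * q v * 2 ^ padicValNat 2 (v + 1) - 1, by
        have := hsplit v
        have := hpos v
        have := v.2
        omega⟩
  have hpar : ∀ v u, par v = some u → (u : ℕ) + 1 = 2 * q v * 2 ^ padicValNat 2 (v + 1) := by
    intro v u h
    simp only [par] at h
    split_ifs at h with h0
    have : 0 < 2 * q v * 2 ^ padicValNat 2 (v + 1) := by
      have := hpos v
      positivity
    rw [← Option.some.inj h]
    show _ - 1 + 1 = _
    omega
  obtain ⟨F, hFc, hF, hFs⟩ := exists_contractsOver_forest w par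
    (fun v => dyadicBlock s (padicValNat 2 (v + 1)) (2 * q v)) (fun v => v)
    (fun v u h => by
      have := hpar v u h
      have := hsplit v
      have := hpos v
      omega)
    (fun v => padicValNat 2 (v + 1))
    (fun v u h => by
      have h1 := hpar v u h
      refine (padicValNat_dvd_iff_le (p := 2) (by omega)).1 ⟨q v, ?_⟩
      rw [h1, pow_succ]
      ring)
    (fun v => s.take (v + 1))
    (fun v => by
      cases hp : par v with
      | none =>
        have h0 : q v = 0 := by
          by_contra h0
          simp [par, h0] at hp
        have h1 := hsplit v
        simp only [h0, mul_zero, zero_mul, zero_add] at h1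
        simp [dyadicBlock, h0, ← h1]
      | some u =>
        simp only [Option.elim_some, dyadicBlock]
        rw [hpar v u hp, ← List.take_add, ← hsplit v])
  refine ⟨F ∪ B, ?_, ?_, ?_⟩
  · have := Finset.card_union_le F B
    have := sum_padicValNat_succ_le n
    omega
  · intro k hk
    exact Finset.mem_union_left _ (hF ⟨k, hk⟩)
  · refine hFs.union hBs (by omega) (by omega) ?_
    rintro _ ⟨v, rfl⟩
    right
    have h1 := hsplit v
    have h2 := v.2
    have h3 : padicValNat 2 (v + 1) ≤ H := by
      rw [← Nat.pow_le_pow_iff_right one_lt_two]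
      omega
    refine hB _ h3 _ ?_
    refine Nat.lt_of_mul_lt_mul_right (a := 2 ^ padicValNat 2 (v + 1)) ?_
    rw [← pow_add, Nat.sub_add_cancel h3]
    have := hpos v
    omega

end Prefixes

section LongPaths

variable {N : Type} [Fintype N] (p : N → Option N) (d : N → ℕ)

theorem exists_forest_height (hd : ∀ v u, p v = some u → d u < d v) :
    ∃ h : N → ℕ, (∀ v u, p v = some u → h v < h u) ∧
      ∀ u, 0 < h u → ∃ v, p v = some u ∧ h u = h v + 1 := by
  classical
  have hwf : WellFounded fun v u => p v = some u := by
    refine Subrelation.wf (r := InvImage (· < ·) fun v => Finset.univ.sup d - d v) ?_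
      (InvImage.wf _ Nat.lt_wfRel.wf)
    intro v u h
    have h1 := hd v u h
    have h2 : d v ≤ Finset.univ.sup d := Finset.le_sup (Finset.mem_univ v)
    show Finset.univ.sup d - d v < Finset.univ.sup d - d u
    omega
  set h : N → ℕ := hwf.fix fun u ih =>
    Finset.univ.sup fun v => if hv : p v = some u then ih v hv + 1 else 0 with hdef
  have heq : ∀ u, h u = Finset.univ.sup fun v => if p v = some u then h v + 1 else 0 := by
    intro u
    rw [hdef, hwf.fix_eq]
    simp only [dite_eq_ite]
  refine ⟨h, fun v u hv => ?_, fun u hu => ?_⟩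
  · have := Finset.le_sup (f := fun v => if p v = some u then h v + 1 else 0) (Finset.mem_univ v)
    rw [← heq, if_pos hv] at this
    omega
  · have hne : (Finset.univ : Finset N).Nonempty := ⟨u, Finset.mem_univ u⟩
    obtain ⟨v, -, hv⟩ := Finset.exists_mem_eq_sup _ hne fun v => if p v = some u then h v + 1 else 0
    rw [← heq] at hv
    split_ifs at hv with hp
    · exact ⟨v, hp, hv⟩
    · omega

/-- The long-path decomposition of a forest: the nodes are partitioned into descending chains, the
chain `C t` starting at its top `t` being a longest one below `t`. -/
theorem exists_longPath_decomposition (hd : ∀ v u, p v = some u → d u < d v)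
    (path : N → List N) (hpath : ∀ v, path v = (p v).elim [] path ++ [v]) :
    ∃ (T : Finset N) (h : N → ℕ) (C : N → List N) (top : N → N) (k : N → ℕ),
      ∑ t ∈ T, (h t + 1) ≤ Fintype.card N ∧ (∀ v u, p v = some u → h v < h u) ∧
      (∀ v, (C v).length = h v + 1) ∧ ∀ v, top v ∈ T ∧ k v ≤ h (top v) ∧ h v ≤ h (top v) ∧
        d (top v) ≤ d v ∧ path v = (p (top v)).elim [] path ++ (C (top v)).take (k v + 1) := by
  classical
  obtain ⟨h, hh, hc⟩ := exists_forest_height p d hd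
  have hc' : ∀ u, ∃ v, 0 < h u → p v = some u ∧ h u = h v + 1 := by
    intro u
    by_cases hu : 0 < h u
    · obtain ⟨v, hv⟩ := hc u hu
      exact ⟨v, fun _ => hv⟩
    · exact ⟨u, fun h => absurd h hu⟩
  choose lc hlc using hc'
  have hiter : ∀ t k, k ≤ h t → h (lc^[k] t) = h t - k := by
    intro t k
    induction k with
    | zero => simp
    | succ k ih =>
      intro hk
      have h1 := ih (by omega)
      have h2 := (hlc (lc^[k] t) (by omega)).2
      rw [Function.iterate_succ_apply']
      omega
  have hparent : ∀ t k, k < h t → p (lc^[k + 1] t) = some (lc^[k] t) := by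
    intro t k hk
    rw [Function.iterate_succ_apply']
    exact (hlc _ (by rw [hiter t k hk.le]; omega)).1
  set T : Finset N := Finset.univ.filter fun t => ∀ u, p t = some u → lc u ≠ t with hT
  set C : N → List N := fun t => (List.range (h t + 1)).map fun k => lc^[k] t with hC
  have htake : ∀ t k, k ≤ h t → (C t).take (k + 1) = (List.range (k + 1)).map fun k => lc^[k] t := by
    intro t k hk
    rw [hC, ← List.map_take, List.take_range, min_eq_left (by omega)]
  have key : ∀ v, ∃ t k, t ∈ T ∧ k ≤ h t ∧ v = lc^[k] t ∧ h v ≤ h t ∧ d t ≤ d v ∧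
      path v = (p t).elim [] path ++ (C t).take (k + 1) := by
    intro v
    induction hn : d v using Nat.strong_induction_on generalizing v with
    | _ n ih =>
      by_cases hv : v ∈ T
      · refine ⟨v, 0, hv, Nat.zero_le _, rfl, le_rfl, hn.le, ?_⟩
        rw [htake v 0 (Nat.zero_le _), hpath v]
        rfl
      · simp only [hT, Finset.mem_filter, Finset.mem_univ, true_and, not_forall, not_not] at hv
        obtain ⟨u, hu, huv⟩ := hv
        have hdu := hd v u hu
        have hhu := hh v u hu
        obtain ⟨t, k, ht, hk, hut, hht, hdt, hp⟩ := ih (d u) (hn ▸ hdu) u rfl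
        have hkt : k < h t := by
          have := hiter t k hk
          rw [← hut] at this
          omega
        refine ⟨t, k + 1, ht, hkt, ?_, by omega, by omega, ?_⟩
        · rw [Function.iterate_succ_apply', ← hut, huv]
        · rw [hpath v, hu, Option.elim_some, hp, htake t k hk, htake t (k + 1) hkt,
            List.range_succ (n := k + 1), List.map_append, List.append_assoc, List.map_singleton,
            Function.iterate_succ_apply', ← hut, huv]
  choose top k htop hk _ hht hdt hp using key
  refine ⟨T, h, C, top, k, ?_, hh, fun v => by simp [hC],
    fun v => ⟨htop v, hk v, hht v, hdt v, hp v⟩⟩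
  have hinj : ∀ j k t t', t ∈ T → t' ∈ T → j ≤ h t → k ≤ h t' → j ≤ k →
      lc^[j] t = lc^[k] t' → t = t' ∧ j = k := by
    intro j
    induction j with
    | zero =>
      intro k t t' ht _ _ hk' _ he
      cases k with
      | zero => exact ⟨he, rfl⟩
      | succ k =>
        have h1 := hparent t' k hk'
        rw [← he] at h1
        exact absurd ((Function.iterate_succ_apply' lc k t').symm.trans he.symm)
          ((Finset.mem_filter.1 ht).2 _ h1)
    | succ j ih =>
      intro k t t' ht ht' hj hk' hjk he
      cases k with
      | zero => omega
      | succ k =>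
        have h1 := hparent t j hj
        rw [he, hparent t' k hk'] at h1
        obtain ⟨h2, h3⟩ := ih k t t' ht ht' (by omega) (by omega) (by omega)
          (Option.some.inj h1).symm
        exact ⟨h2, by omega⟩
  have hcard : ∑ t ∈ T, (h t + 1) = (T.sigma fun t => Finset.range (h t + 1)).card := by
    simp
  rw [hcard, ← Finset.card_univ]
  refine Finset.card_le_card_of_injOn (fun x => lc^[x.2] x.1) (fun _ _ => Finset.mem_univ _) ?_
  rintro ⟨t, j⟩ hx ⟨t', j'⟩ hx' he
  simp only [Finset.coe_sigma, Set.mem_sigma_iff, Finset.mem_coe, Finset.mem_range] at hx hx'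
  rcases le_total j j' with hj | hj
  · obtain ⟨rfl, rfl⟩ := hinj j j' t t' hx.1 hx'.1 (by omega) (by omega) hj he
    rfl
  · obtain ⟨rfl, rfl⟩ := hinj j' j t' t hx'.1 hx.1 (by omega) (by omega) hj he.symm
    rfl

/-- The path words of a forest belong to a contracting family of linear size. -/
theorem exists_contractsOver_paths (w : N → ℕ) (hd : ∀ v u, p v = some u → d u < d v)
    (path : N → List N) (hpath : ∀ v, path v = (p v).elim [] path ++ [v]) :
    ∃ F : Finset (List N), F.card ≤ 32 * Fintype.card N ∧ (∀ v, path v ∈ F) ∧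
      ContractsOver w {x | x.length ≤ 1} F 864 := by
  classical
  obtain ⟨T, h, C, top, k, hsum, hh, hC, hdec⟩ := exists_longPath_decomposition p d hd path hpath
  have hCne : ∀ v, C v ≠ [] := fun v => by
    rw [← List.length_pos_iff, hC]
    omega
  choose E hEc hE hEs using fun v => exists_contractsOver_prefixes w (C v) (hCne v)
  have hGs := ContractsOver.biUnion T E fun t _ => hEs t
  have hGc : (T.biUnion E).card ≤ 30 * Fintype.card N := by
    refine Finset.card_biUnion_le.trans ((Finset.sum_le_sum fun t _ => hEc t).trans ?_)
    rw [← Finset.mul_sum]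
    simp only [hC]
    omega
  have hG : ∀ v, (C (top v)).take (k v + 1) ∈ T.biUnion E := by
    intro v
    obtain ⟨h1, h2, -⟩ := hdec v
    exact Finset.mem_biUnion.2 ⟨_, h1, hE _ _ (by rw [hC]; omega)⟩
  generalize T.biUnion E = G at hGs hGc hG
  obtain ⟨F, hFc, hF, hFs⟩ := exists_contractsOver_forest w
    (fun t : T => (p t).map fun q => (⟨top q, (hdec q).1⟩ : T))
    (fun t => (p t).elim [] fun q => (C (top q)).take (k q + 1)) (fun t => d t)
    (fun t u hu => by
      obtain ⟨q, hq, rfl⟩ := Option.map_eq_some_iff.1 hu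
      exact (hdec q).2.2.2.1.trans_lt (hd _ _ hq))
    (fun t => h t)
    (fun t u hu => by
      obtain ⟨q, hq, rfl⟩ := Option.map_eq_some_iff.1 hu
      exact (hh _ _ hq).trans_le (hdec q).2.2.1)
    (fun t => (p t).elim [] path)
    (fun t => by
      cases hp : p t with
      | none => simp
      | some q => simpa using (hdec q).2.2.2.2)
  rw [Finset.sum_coe_sort T fun t => h t + 1] at hFc
  have hFG := hFs.union hGs (by omega) (by omega) (by
    rintro _ ⟨t, rfl⟩
    dsimp only
    cases hp : p t with
    | none => exact Or.inl (by simp)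
    | some q => exact Or.inr (hG q))
  have hP : ContractsOver w {x | x ∈ F ∪ G} (Finset.univ.image path) 2 := by
    intro s hs
    obtain ⟨v, -, rfl⟩ := Finset.mem_image.1 hs
    obtain ⟨h1, -, -, -, h2⟩ := hdec v
    rw [h2]
    exact (Splits.single (Or.inl (Finset.mem_union_left _ (hF ⟨_, h1⟩)))).append
      (Splits.single (Or.inl (Finset.mem_union_right _ (hG v))))
  refine ⟨Finset.univ.image path ∪ (F ∪ G), ?_, fun v => ?_,
    hP.union hFG (by omega) (by omega) fun x hx => Or.inr hx⟩
  · have h1 := Finset.card_union_le (Finset.univ.image path) (F ∪ G)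
    have h2 := Finset.card_union_le F G
    have h3 : (Finset.univ.image path).card ≤ Fintype.card N := Finset.card_image_le
    omega
  · exact Finset.mem_union_left _ (Finset.mem_image_of_mem _ (Finset.mem_univ v))

end LongPaths

section HeavyChild

theorem Splits.map {α β : Type} {P : List α → Prop} {k : ℕ} {q : List α} (φ : List α → List β)
    (hφ : ∀ l : List (List α), ∃ l' : List (List β), l'.Perm (l.map φ) ∧ φ l.flatten = l'.flatten)
    (hq : Splits P k q) : Splits (fun x => ∃ y, P y ∧ φ y = x) k (φ q) := by
  obtain ⟨l, hl, hP, rfl⟩ := hq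
  obtain ⟨l', hl', heq⟩ := hφ l
  refine ⟨l', by simpa [hl'.length_eq] using hl, fun x hx => ?_, heq.symm⟩
  obtain ⟨y, hy, rfl⟩ := List.mem_map.1 (hl'.subset hx)
  exact ⟨y, hP y hy, rfl⟩

variable {Γ N : Type}

theorem flatMap_flatten (f : N → List Γ) (l : List (List N)) :
    l.flatten.flatMap f = (l.map fun q => q.flatMap f).flatten := by
  induction l with
  | nil => rfl
  | cons a l ih => simp [ih]

theorem flatMap_reverse_flatten (f : N → List Γ) (l : List (List N)) :
    l.flatten.reverse.flatMap f = (l.map fun q => q.reverse.flatMap f).reverse.flatten := by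
  induction l with
  | nil => rfl
  | cons a l ih => simp [ih]

/-- A binary splitting of `s` into words of `B` has at most one child that is longer than half of
`s`; `a` and `b` are its siblings. -/
theorem exists_heavy_child (B : Finset (List Γ)) (s : List Γ)
    (hs : s.length ≤ 1 ∨ ∃ x ∈ B, ∃ y ∈ B, x ≠ [] ∧ y ≠ [] ∧ s = x ++ y) :
    ∃ (q : Option B) (a b : List Γ),
      (∀ u : B, q = some u → u.1.length < s.length ∧ s = a ++ u.1 ++ b) ∧
      (q = none → a = [] ∧ b = [] ∧
        Splits (fun x => x.length ≤ 1 ∨ x ∈ B ∧ 2 * x.length ≤ s.length) 2 s) ∧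
      (a = [] ∨ a ∈ B ∧ 2 * a.length ≤ s.length) ∧ (b = [] ∨ b ∈ B ∧ 2 * b.length ≤ s.length) := by
  rcases hs with hs | ⟨x, hx, y, hy, hx0, hy0, rfl⟩
  · exact ⟨none, [], [], by simp, fun _ => ⟨rfl, rfl, (Splits.single (Or.inl hs)).mono (by omega)
      fun _ h _ => h⟩, Or.inl rfl, Or.inl rfl⟩
  have hx1 := List.length_pos_iff.2 hx0
  have hy1 := List.length_pos_iff.2 hy0
  simp only [List.length_append]
  by_cases h1 : 2 * x.length ≤ x.length + y.length
  · by_cases h2 : 2 * y.length ≤ x.length + y.length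
    · exact ⟨none, [], [], by simp, fun _ => ⟨rfl, rfl, (Splits.single (Or.inr ⟨hx, h1⟩)).append
        (Splits.single (Or.inr ⟨hy, h2⟩))⟩, Or.inl rfl, Or.inl rfl⟩
    · refine ⟨some ⟨y, hy⟩, x, [], ?_, by simp, Or.inr ⟨hx, h1⟩, Or.inl rfl⟩
      rintro _ ⟨⟩
      exact ⟨by simp only; omega, by simp⟩
  · refine ⟨some ⟨x, hx⟩, [], y, ?_, by simp, Or.inl rfl, Or.inr ⟨hy, by omega⟩⟩
    rintro _ ⟨⟩
    exact ⟨by simp only; omega, by simp⟩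

open Classical in
theorem ContractsOver.image {w : N → ℕ} {F : Finset (List N)} {k : ℕ}
    (hF : ContractsOver w {x | x.length ≤ 1} F k) (φ : List N → List Γ)
    (hφ : ∀ l : List (List N), ∃ l' : List (List Γ), l'.Perm (l.map φ) ∧ φ l.flatten = l'.flatten)
    (hlen : ∀ q, (φ q).length = wstr w q) :
    ContractsOver (fun _ => 1) {x | ∃ y, y.length ≤ 1 ∧ φ y = x} (F.image φ) k := by
  intro s hs
  obtain ⟨q, hq, rfl⟩ := Finset.mem_image.1 hs
  refine ((hF q hq).map φ hφ).mono le_rfl ?_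
  rintro _ ⟨y, hy | ⟨hy, hyq⟩, rfl⟩ -
  · exact Or.inl ⟨y, hy, rfl⟩
  · refine Or.inr ⟨Finset.mem_image_of_mem _ hy, ?_⟩
    simpa only [wstr_one_eq_length, hlen] using hyq

open Classical in
/-- A finite set of words in which every word of length at least two is a product of two nonempty
members can be enlarged by a constant factor to a set contracting with respect to length. -/
theorem exists_contractsOver_of_binary (B : Finset (List Γ))
    (hB : ∀ s ∈ B, s.length ≤ 1 ∨ ∃ x ∈ B, ∃ y ∈ B, x ≠ [] ∧ y ≠ [] ∧ s = x ++ y) :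
    ∃ F : Finset (List Γ), F.card ≤ 65 * B.card ∧ B ⊆ F ∧
      ContractsOver (fun _ => 1) {x | x.length ≤ 1} F (864 * 1730) := by
  choose p ll rl hsome hnone hll hrl using fun s : B => exists_heavy_child B s.1 (hB s.1 s.2)
  set d : B → ℕ := fun s => s.1.length with hd'
  have hd : ∀ v u, p v = some u → d u < d v := fun v u h => (hsome v u h).1
  set path : B → List B := stackSuffix (fun _ => 0) p (fun v => [v]) d hd 0 with hpath'
  have hpath : ∀ v, path v = (p v).elim [] path ++ [v] := fun v => stackSuffix_zero _ _ _ _ _ v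
  have hmem : ∀ v, ∀ x ∈ path v, d x ≤ d v := by
    intro v
    induction hn : d v using Nat.strong_induction_on generalizing v with
    | _ n ih =>
      intro x hx
      rw [hpath, List.mem_append, List.mem_singleton] at hx
      rcases hx with hx | rfl
      · cases hp : p v with
        | none => simp [hp] at hx
        | some u =>
          rw [hp] at hx
          have h1 := hd _ _ hp
          have := ih (d u) (hn ▸ h1) u rfl x hx
          omega
      · exact hn.le
  have hdecomp : ∀ v : B, ∃ r, v.1 = (path v).reverse.flatMap ll ++ r ++ (path v).flatMap rl ∧
      Splits (fun x => x.length ≤ 1 ∨ x ∈ B ∧ 2 * x.length ≤ v.1.length) 2 r := by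
    intro v
    induction hn : d v using Nat.strong_induction_on generalizing v with
    | _ n ih =>
      cases hp : p v with
      | none =>
        obtain ⟨h1, h2, h3⟩ := hnone v hp
        exact ⟨v.1, by simp [hpath v, hp, h1, h2], h3⟩
      | some u =>
        obtain ⟨h1, h2⟩ := hsome v u hp
        obtain ⟨r, hr, hrs⟩ := ih (d u) (hn ▸ h1) u rfl
        refine ⟨r, ?_, hrs.mono le_rfl fun x hx _ => hx.imp id fun hx => ⟨hx.1, by omega⟩⟩
        rw [hpath v, hp]
        conv_lhs => rw [h2, hr]
        simp
  have side : ∀ (φ : List B → List Γ) (lab : B → List Γ),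
      (∀ l : List (List B), ∃ l' : List (List Γ),
        l'.Perm (l.map φ) ∧ φ l.flatten = l'.flatten) →
      (∀ q, (φ q).length = wstr (fun x => (lab x).length) q) → φ [] = [] →
      (∀ x, φ [x] = lab x) → (∀ x, lab x = [] ∨ lab x ∈ B ∧ 2 * (lab x).length ≤ x.1.length) →
      ∃ W : Finset (List Γ), W.card ≤ 32 * B.card ∧
        ContractsOver (fun _ => 1) {x | x.length ≤ 1 ∨ x ∈ B} W 864 ∧
        ∀ v : B, (φ (path v)).length ≤ v.1.length →
          Splits (fun x => x.length ≤ 1 ∨ x ∈ B ∪ W ∧ 2 * x.length ≤ v.1.length) 864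
            (φ (path v)) := by
    intro φ lab hφ hlen hnil hsing hlab
    obtain ⟨F, hFc, hF, hFs⟩ := exists_contractsOver_paths p d (fun x => (lab x).length) hd path hpath
    refine ⟨F.image φ, Finset.card_image_le.trans (by simpa using hFc), ?_, ?_⟩
    · intro s hs
      refine (hFs.image φ hφ hlen s hs).mono le_rfl ?_
      rintro _ (⟨y, hy, rfl⟩ | hx) -
      · rcases y with _ | ⟨x, _ | _⟩
        · exact Or.inl (Or.inl (by simp [hnil]))
        · rcases hlab x with h | h
          · exact Or.inl (Or.inl (by simp [hsing, h]))
          · exact Or.inl (Or.inr (by simp [hsing, h]))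
        · simp at hy
      · exact Or.inr hx
    · intro v hv
      refine (((hFs (path v) (hF v)).mono (Q := fun y => ((y.length ≤ 1) ∨ y ∈ F ∧
        2 * wstr (fun x => (lab x).length) y ≤ wstr (fun x => (lab x).length) (path v)) ∧
        y <:+: path v) le_rfl fun _ h h' => ⟨h, h'⟩).map φ hφ).mono le_rfl ?_
      rintro _ ⟨y, ⟨hy | ⟨hy, hyv⟩, hyi⟩, rfl⟩ -
      · rcases y with _ | ⟨x, _ | _⟩
        · exact Or.inl (by simp [hnil])
        · rcases hlab x with h | ⟨h, h'⟩
          · exact Or.inl (by simp [hsing, h])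
          · have hxv : x.1.length ≤ v.1.length := hmem v x (hyi.subset (by simp))
            rw [hsing]
            exact Or.inr ⟨Finset.mem_union_left _ h, by omega⟩
        · simp at hy
      · refine Or.inr ⟨Finset.mem_union_right _ (Finset.mem_image_of_mem _ hy), ?_⟩
        rw [← hlen, ← hlen] at hyv
        omega
  obtain ⟨R, hRc, hRs, hR⟩ := side (fun q => q.flatMap rl) rl
    (fun l => ⟨_, List.Perm.refl _, flatMap_flatten rl l⟩)
    (fun q => by simp [wstr, List.length_flatMap]) rfl (by simp) hrl
  obtain ⟨L, hLc, hLs, hL⟩ := side (fun q => q.reverse.flatMap ll) ll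
    (fun l => ⟨_, List.reverse_perm _, flatMap_reverse_flatten ll l⟩)
    (fun q => by simp [wstr, List.length_flatMap, List.sum_reverse]) rfl (by simp) hll
  have hBs : ∀ v ∈ B, Splits (fun x => x ∈ {x : List Γ | x.length ≤ 1} ∨
      x ∈ B ∪ (R ∪ L) ∧ 2 * wstr (fun _ => 1) x ≤ wstr (fun _ => 1) v) 1730 v := by
    intro v hv
    simp only [wstr_one_eq_length, Set.mem_ofPred_eq]
    obtain ⟨r, hr, hrs⟩ := hdecomp ⟨v, hv⟩
    have hlen := congrArg List.length hr
    simp only [List.length_append] at hlen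
    have h1 := hL ⟨v, hv⟩ (by simp only; omega)
    have h2 := hR ⟨v, hv⟩ (by simp only; omega)
    simp only at h1 h2 hrs hr
    have key := ((h1.mono (Q := fun x => x.length ≤ 1 ∨ x ∈ B ∪ (R ∪ L) ∧ 2 * x.length ≤ v.length)
      le_rfl ?_).append (hrs.mono le_rfl ?_)).append (h2.mono le_rfl ?_)
    · rwa [← hr] at key
    all_goals
      rintro x (hx | ⟨hx, hxv⟩) -
      · exact Or.inl hx
      · refine Or.inr ⟨?_, hxv⟩
        simp only [Finset.mem_union] at hx ⊢
        tauto
  have hW : ∀ W ⊆ R ∪ L, ContractsOver (fun _ => 1) {x : List Γ | x.length ≤ 1 ∨ x ∈ B} W 864 →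
      ∀ s ∈ W, Splits (fun x => x ∈ {x : List Γ | x.length ≤ 1} ∨
        x ∈ B ∪ (R ∪ L) ∧ 2 * wstr (fun _ => 1) x ≤ wstr (fun _ => 1) s) (864 * 1730) s := by
    intro W hWsub hWs s hs
    refine (hWs s hs).bind ?_
    rintro x ((hx | hx) | ⟨hx, hxs⟩) hi
    · exact (Splits.single (Or.inl hx)).mono (by omega) fun _ h _ => h
    · refine (hBs x hx).mono le_rfl fun y hy _ => hy.imp id fun hy => ⟨hy.1, ?_⟩
      exact hy.2.trans (hi.wstr_le _)
    · exact (Splits.single (Or.inr ⟨Finset.mem_union_right _ (hWsub hx), hxs⟩)).mono (by omega)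
        fun _ h _ => h
  refine ⟨B ∪ (R ∪ L), ?_, Finset.subset_union_left, ?_⟩
  · have := Finset.card_union_le B (R ∪ L)
    have := Finset.card_union_le R L
    omega
  · intro s hs
    rcases Finset.mem_union.1 hs with hs | hs
    · exact (hBs s hs).mono (by omega) fun _ h _ => h
    · rcases Finset.mem_union.1 hs with hs | hs
      · exact hW R Finset.subset_union_left hRs s hs
      · exact hW L Finset.subset_union_right hLs s hs

end HeavyChild

namespace SLP

variable {V Γ : Type}

/-- The string derived by a symbol. -/
def symVal (G : SLP V Γ) : V ⊕ Γ → List Γ := Sum.elim G.val fun a => [a]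

theorem val_eq_flatMap (G : SLP V Γ) (A : V) : G.val A = (G.rhs A).flatMap G.symVal := by
  rw [val, List.flatMap]
  conv_rhs => rw [← List.attach_map_subtype_val (G.rhs A), List.map_map]
  congr 2
  funext β
  rcases β with ⟨_ | _, _⟩ <;> rfl

/-- The nonempty strings derived by symbols or prefixes of right-hand sides form a set of linear
size in which every word of length at least two is a product of two members. -/
theorem exists_binary [Fintype V] (G : SLP V Γ) :
    ∃ B : Finset (List Γ), B.card ≤ 2 * G.size ∧ (∀ A, G.val A ≠ [] → G.val A ∈ B) ∧
      ∀ s ∈ B, s.length ≤ 1 ∨ ∃ x ∈ B, ∃ y ∈ B, x ≠ [] ∧ y ≠ [] ∧ s = x ++ y := by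
  classical
  set B : Finset (List Γ) := (Finset.univ.biUnion fun A =>
    (Finset.range (G.rhs A).length).image (fun i => ((G.rhs A).take (i + 1)).flatMap G.symVal) ∪
      ((G.rhs A).map G.symVal).toFinset).filter (· ≠ []) with hB
  have hpre : ∀ A i, i ≤ (G.rhs A).length → ((G.rhs A).take i).flatMap G.symVal ≠ [] →
      ((G.rhs A).take i).flatMap G.symVal ∈ B := by
    intro A i hi hne
    cases i with
    | zero => simp at hne
    | succ i =>
      refine Finset.mem_filter.2 ⟨Finset.mem_biUnion.2 ⟨A, Finset.mem_univ A, ?_⟩, hne⟩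
      exact Finset.mem_union_left _ (Finset.mem_image.2 ⟨i, Finset.mem_range.2 hi, rfl⟩)
  have hsym : ∀ A, ∀ β ∈ G.rhs A, G.symVal β ≠ [] → G.symVal β ∈ B := by
    intro A β hβ hne
    refine Finset.mem_filter.2 ⟨Finset.mem_biUnion.2 ⟨A, Finset.mem_univ A, ?_⟩, hne⟩
    exact Finset.mem_union_right _ (List.mem_toFinset.2 (List.mem_map_of_mem hβ))
  have hval : ∀ A, G.val A = ((G.rhs A).take (G.rhs A).length).flatMap G.symVal := fun A => by
    rw [List.take_length, val_eq_flatMap]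
  set good : List Γ → Prop := fun s =>
    s.length ≤ 1 ∨ ∃ x ∈ B, ∃ y ∈ B, x ≠ [] ∧ y ≠ [] ∧ s = x ++ y
  have hgood : ∀ A i, i ≤ (G.rhs A).length → good (((G.rhs A).take i).flatMap G.symVal) := by
    intro A
    induction hn : G.rank A using Nat.strong_induction_on generalizing A with
    | _ n ih =>
      intro i
      induction i with
      | zero => exact fun _ => Or.inl (by simp)
      | succ i ihi =>
        intro hi
        rw [List.take_succ_eq_append_getElem hi, List.flatMap_append, List.flatMap_singleton]
        have hmem : (G.rhs A)[i] ∈ G.rhs A := List.getElem_mem hi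
        by_cases h1 : G.symVal (G.rhs A)[i] = []
        · rw [h1, List.append_nil]
          exact ihi (by omega)
        by_cases h2 : ((G.rhs A).take i).flatMap G.symVal = []
        · rw [h2, List.nil_append]
          cases hβ : (G.rhs A)[i] with
          | inr a => exact Or.inl (by simp [symVal])
          | inl A' =>
            have := ih (G.rank A') (hn ▸ G.rank_lt _ _ (hβ ▸ hmem)) A' rfl _ le_rfl
            rwa [← hval] at this
        · exact Or.inr ⟨_, hpre A i (by omega) h2, _, hsym A _ hmem h1, h2, h1, rfl⟩
  refine ⟨B, ?_, fun A hA => ?_, fun s hs => ?_⟩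
  · refine (Finset.card_filter_le _ _).trans (Finset.card_biUnion_le.trans ?_)
    rw [size, Finset.mul_sum]
    refine Finset.sum_le_sum fun A _ => (Finset.card_union_le _ _).trans ?_
    have h1 := Finset.card_image_le (s := Finset.range (G.rhs A).length)
      (f := fun i => ((G.rhs A).take (i + 1)).flatMap G.symVal)
    have h2 := List.toFinset_card_le ((G.rhs A).map G.symVal)
    simp only [Finset.card_range, List.length_map] at h1 h2
    omega
  · rw [hval] at hA ⊢
    exact hpre A _ le_rfl hA
  · obtain ⟨hs, -⟩ := Finset.mem_filter.1 hs
    obtain ⟨A, -, hs⟩ := Finset.mem_biUnion.1 hs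
    rcases Finset.mem_union.1 hs with hs | hs
    · obtain ⟨i, hi, rfl⟩ := Finset.mem_image.1 hs
      exact hgood A _ (Finset.mem_range.1 hi)
    · obtain ⟨β, hβ, rfl⟩ := List.mem_map.1 (List.mem_toFinset.1 hs)
      cases β with
      | inr a => exact Or.inl (by simp [symVal])
      | inl A' =>
        have := hgood A' _ le_rfl
        rwa [← hval] at this

/-- A finite contracting set of words is the set of words defined by a contracting program. -/
theorem exists_contracting_of_contractsOver (F : Finset (List Γ)) (k : ℕ)
    (hF : ContractsOver (fun _ => 1) {x | x.length ≤ 1} F k) :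
    ∃ (V : Type) (_ : Fintype V) (G : SLP V Γ), G.size ≤ k * F.card ∧
      (∀ A, (G.rhs A).length ≤ k) ∧ G.Contracting (fun _ => 1) ∧ G.defines [] ∧
      ∀ s ∈ F, G.defines s := by
  classical
  have hrhs : ∀ s : {s // s ∈ insert [] F}, ∃ u : List ({s // s ∈ insert [] F} ⊕ Γ),
      u.length ≤ (if s.1 ∈ F then k else 0) ∧
      (∀ t, Sum.inl t ∈ u → 2 * t.1.length ≤ s.1.length ∧ 1 < t.1.length) ∧
      u.flatMap (Sum.elim (fun t => t.1) fun a => [a]) = s.1 := by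
    intro s
    by_cases hs : s.1 ∈ F
    · rw [if_pos hs]
      obtain ⟨l, hl, hP, heq⟩ := hF s.1 hs
      suffices ∀ l : List (List Γ), (∀ x ∈ l, x.length ≤ 1 ∨ x ∈ F ∧ 2 * x.length ≤ s.1.length) →
          ∃ u : List ({s // s ∈ insert [] F} ⊕ Γ), u.length ≤ l.length ∧
            (∀ t, Sum.inl t ∈ u → 2 * t.1.length ≤ s.1.length ∧ 1 < t.1.length) ∧
            u.flatMap (Sum.elim (fun t => t.1) fun a => [a]) = l.flatten by
        obtain ⟨u, h1, h2, h3⟩ := this l (by simpa only [wstr_one_eq_length, Set.mem_ofPred_eq] using hP)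
        exact ⟨u, h1.trans hl, h2, h3.trans heq⟩
      intro l hl
      induction l with
      | nil => exact ⟨[], by simp, by simp, rfl⟩
      | cons x l ih =>
        obtain ⟨u, h1, h2, h3⟩ := ih fun y hy => hl y (List.mem_cons_of_mem _ hy)
        by_cases hx : x.length ≤ 1
        · refine ⟨x.map Sum.inr ++ u, by simp; omega, by simpa using h2, ?_⟩
          simp [h3, List.flatMap_map]
        · obtain ⟨hxF, hxs⟩ := (hl x (by simp)).resolve_left hx
          refine ⟨Sum.inl ⟨x, Finset.mem_insert_of_mem hxF⟩ :: u, by simpa using h1, ?_, by simp [h3]⟩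
          intro t ht
          rcases List.mem_cons.1 ht with ht | ht
          · rw [Sum.inl.inj ht]
            exact ⟨hxs, by simp only; omega⟩
          · exact h2 t ht
    · have : s.1 = [] := (Finset.mem_insert.1 s.2).resolve_right hs
      exact ⟨[], by simp, by simp, by simp [this]⟩
  choose u hlen hhalf heq using hrhs
  let G : SLP {s // s ∈ insert [] F} Γ :=
    { rhs := u
      rank := fun s => s.1.length
      rank_lt := fun A B h => by
        have := hhalf A B h
        omega
      start := ⟨[], Finset.mem_insert_self _ _⟩ }
  have hval : ∀ s, G.val s = s.1 := by
    intro s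
    induction hn : s.1.length using Nat.strong_induction_on generalizing s with
    | _ n ih =>
      rw [val_eq_flatMap, ← heq s]
      refine List.flatMap_congr fun β hβ => ?_
      cases β with
      | inr a => rfl
      | inl t => exact ih _ (hn ▸ G.rank_lt _ _ hβ) t rfl
  have hk : ∀ A, (u A).length ≤ k := fun A => (hlen A).trans (by split_ifs <;> omega)
  refine ⟨_, inferInstance, G, ?_, hk, ?_, ⟨⟨[], Finset.mem_insert_self _ _⟩, hval _⟩,
    fun s hs => ⟨⟨s, Finset.mem_insert_of_mem hs⟩, hval _⟩⟩
  · refine (Finset.sum_le_sum fun A _ => hlen A).trans ?_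
    rw [Finset.sum_coe_sort (insert [] F) fun s => if s ∈ F then k else 0, ← Finset.sum_filter]
    rw [Finset.sum_const, smul_eq_mul, mul_comm]
    refine Nat.mul_le_mul_left _ (Finset.card_le_card fun s hs => (Finset.mem_filter.1 hs).2)
  · intro A B h
    simp only [wval, hval, wstr_one_eq_length]
    exact (hhalf A B h).1

end SLP
/-- There is a constant `c ≥ 1` such that every SLP `G` of size `g`
can be transformed into an SLP `G'` of size at most `c·g`, with right-hand sides of
length at most `c`, which is contracting with respect to the length weight
(every variable `B` on the right-hand side of the rule of `A` satisfies
`|val B| ≤ |val A| / 2`), and which defines every string that `G` defines. -/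
theorem contracting_slp_transformation :
    ∃ c : ℕ, 1 ≤ c ∧
      ∀ (V Γ : Type) (instV : Fintype V) (G : SLP V Γ),
        ∃ (V' : Type) (instV' : Fintype V') (G' : SLP V' Γ),
          @SLP.size V' Γ instV' G' ≤ c * @SLP.size V Γ instV G ∧
          (∀ A : V', (G'.rhs A).length ≤ c) ∧
          G'.Contracting (fun _ => 1) ∧
          (∀ s : List Γ, G.defines s → G'.defines s) := by
  refine ⟨864 * 1730 * 130, by omega, fun V Γ instV G => ?_⟩
  obtain ⟨B, hBc, hBval, hB⟩ := G.exists_binary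
  obtain ⟨F, hFc, hBF, hF⟩ := exists_contractsOver_of_binary B hB
  obtain ⟨V', instV', G', hsize, hlen, hcon, hnil, hdef⟩ :=
    SLP.exists_contracting_of_contractsOver F _ hF
  refine ⟨V', instV', G', by omega, fun A => (hlen A).trans (by omega), hcon, ?_⟩
  rintro _ ⟨A, rfl⟩
  by_cases hA : G.val A = []
  · rwa [hA]
  · exact hdef _ (hBF (hBval A hA))
end

section
/- There exists a constant c such that for every weighted string s of length n ≥ 1 over a weighted alphabet Σ there is a contracting SLP over Σ with at most c·n variables, in which every right-hand side has length at most 10, that defines all nonempty prefixes of s (i.e., for every 1 ≤ k ≤ n some variable derives the prefix of s of length k). -/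
namespace ContractingSLP

variable {Γ : Type}

theorem wstr_append (w : Γ → ℕ) (s t : List Γ) : wstr w (s ++ t) = wstr w s + wstr w t := by
  simp [wstr]

/-- The factor of `s` between the positions `a` and `b`. -/
def seg (s : List Γ) (a b : ℕ) : List Γ := (s.take b).drop a

theorem seg_append_seg (s : List Γ) {a b c : ℕ} (hab : a ≤ b) (hbc : b ≤ c) :
    seg s a b ++ seg s b c = seg s a c := by
  have h : (s.take c).take b = s.take b := by rw [List.take_take, min_eq_left hbc]
  unfold seg
  rw [← h, List.drop_take, ← Nat.add_sub_cancel' hab, ← List.drop_drop]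
  simp

theorem seg_self (s : List Γ) (a : ℕ) : seg s a a = [] := by
  simp [seg]

theorem seg_zero (s : List Γ) (b : ℕ) : seg s 0 b = s.take b := by
  simp [seg]

theorem seg_append_left (s t : List Γ) {a b : ℕ} (hb : b ≤ s.length) :
    seg (s ++ t) a b = seg s a b := by
  simp [seg, List.take_append_of_le_length hb]

theorem seg_append_right (s t : List Γ) (a b : ℕ) :
    seg (s ++ t) (s.length + a) (s.length + b) = seg t a b := by
  unfold seg
  rw [List.take_length_add_append, List.drop_length_add_append]

theorem wstr_seg_add (w : Γ → ℕ) (s : List Γ) {a b c : ℕ} (hab : a ≤ b) (hbc : b ≤ c) :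
    wstr w (seg s a b) + wstr w (seg s b c) = wstr w (seg s a c) := by
  rw [← wstr_append, seg_append_seg s hab hbc]

/-- Every nonempty weighted list has an element such that the parts before and after it
weigh at most half of the total. -/
theorem exists_middle {α : Type} (f : α → ℕ) (T : ℕ) (l : List α) : ∀ a : ℕ, l ≠ [] →
    2 * a ≤ T → a + (l.map f).sum = T →
    ∃ l₁ x l₂, l = l₁ ++ x :: l₂ ∧ 2 * (a + (l₁.map f).sum) ≤ T ∧ 2 * (l₂.map f).sum ≤ T := by
  induction l with
  | nil => intro a h; exact absurd rfl h
  | cons x t ih =>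
    intro a _ ha hT
    simp only [List.map_cons, List.sum_cons] at hT
    by_cases ht : 2 * (t.map f).sum ≤ T
    · exact ⟨[], x, t, rfl, by simpa using ha, ht⟩
    · have hne : t ≠ [] := by
        rintro rfl
        simp at ht
      obtain ⟨l₁, y, l₂, rfl, h₁, h₂⟩ := ih (a + f x) hne (by omega) (by omega)
      refine ⟨x :: l₁, y, l₂, rfl, ?_, h₂⟩
      simp only [List.map_cons, List.sum_cons]
      omega

theorem wstr_flatten (w : Γ → ℕ) (l : List (List Γ)) :
    wstr w l.flatten = (l.map (wstr w)).sum := by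
  induction l with
  | nil => rfl
  | cons x t ih => rw [List.flatten_cons, wstr_append, ih]; rfl

/-- A rule is the list of strings derived by the symbols of a right-hand side; the rule list `R`
derives `x` if `x` is the concatenation of one of its rules. -/
def Derives (R : List (List (List Γ))) (x : List Γ) : Prop := ∃ r ∈ R, r.flatten = x

/-- `x` may be used in a rule of total weight `n`. -/
def Piece (w : Γ → ℕ) (R : List (List (List Γ))) (n : ℕ) (x : List Γ) : Prop :=
  x = [] ∨ x.length = 1 ∨ (Derives R x ∧ 2 * wstr w x ≤ n)

/-- All rules are contracting and only use letters and derived strings. -/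
def Sound (w : Γ → ℕ) (R : List (List (List Γ))) : Prop :=
  ∀ r ∈ R, ∀ x ∈ r, Piece w R (wstr w r.flatten) x

/-- The number of factors of all rules, which bounds the number of variables needed to
replace the rules by short ones. -/
def cost (R : List (List (List Γ))) : ℕ := (R.map fun r => (r.length + 1) ^ 2).sum

theorem cost_append (A B : List (List (List Γ))) : cost (A ++ B) = cost A + cost B := by
  simp [cost]

theorem cost_map_le {ι : Type} (L : List ι) (f : ι → List (List Γ)) (k : ℕ)
    (h : ∀ i ∈ L, (f i).length ≤ k) : cost (L.map f) ≤ L.length * (k + 1) ^ 2 := by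
  unfold cost
  have := List.sum_le_card_nsmul ((L.map f).map fun r => (r.length + 1) ^ 2) ((k + 1) ^ 2) (by
    intro x hx
    simp only [List.map_map, List.mem_map] at hx
    obtain ⟨i, hi, rfl⟩ := hx
    exact Nat.pow_le_pow_left (Nat.succ_le_succ (h i hi)) 2)
  simpa using this

theorem Derives.mono {R R' : List (List (List Γ))} {x : List Γ} (h : Derives R x)
    (hR : ∀ r ∈ R, r ∈ R') : Derives R' x := by
  obtain ⟨r, hr, hx⟩ := h
  exact ⟨r, hR r hr, hx⟩

theorem Piece.mono {w : Γ → ℕ} {R R' : List (List (List Γ))} {n n' : ℕ} {x : List Γ}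
    (h : Piece w R n x) (hR : ∀ r ∈ R, r ∈ R') (hn : n ≤ n') : Piece w R' n' x := by
  rcases h with h | h | ⟨h, h'⟩
  · exact Or.inl h
  · exact Or.inr (Or.inl h)
  · exact Or.inr (Or.inr ⟨h.mono hR, h'.trans hn⟩)

theorem Sound.append {w : Γ → ℕ} {A R : List (List (List Γ))} (hR : Sound w R)
    (hA : ∀ r ∈ A, ∀ x ∈ r, Piece w R (wstr w r.flatten) x) : Sound w (A ++ R) := by
  intro r hr x hx
  have hsub : ∀ r ∈ R, r ∈ A ++ R := fun r hr => List.mem_append_right _ hr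
  rcases List.mem_append.1 hr with hr | hr
  · exact (hA r hr x hx).mono hsub le_rfl
  · exact (hR r hr x hx).mono hsub le_rfl

/-- `x` is a product of at most `k` letters and elements of `F` of at most half its weight. -/
def Splits (w : Γ → ℕ) (F : List (List Γ)) (k : ℕ) (x : List Γ) : Prop :=
  ∃ l : List (List Γ), l.length ≤ k ∧ l.flatten = x ∧
    ∀ y ∈ l, y = [] ∨ y.length = 1 ∨ (y ∈ F ∧ 2 * wstr w y ≤ wstr w x)

/-- All concatenations of factors of rules. -/
def factors (R : List (List (List Γ))) : List (List Γ) :=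
  R.flatMap fun r => (List.range (r.length + 1)).flatMap fun i =>
    (List.range (r.length + 1)).map fun j => (seg r i j).flatten

theorem length_factors (R : List (List (List Γ))) : (factors R).length = cost R := by
  simp [factors, cost, List.length_flatMap, sq]

theorem mem_factors_of_append {R : List (List (List Γ))} {a b c : List (List Γ)}
    (h : a ++ b ++ c ∈ R) : b.flatten ∈ factors R := by
  simp only [factors, List.mem_flatMap, List.mem_map, List.mem_range]
  refine ⟨_, h, a.length, by simp, a.length + b.length, by simp, ?_⟩
  have h1 := seg_append_right a (b ++ c) 0 b.length
  rw [Nat.add_zero, seg_zero] at h1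
  rw [List.append_assoc, h1]
  simp

theorem exists_of_mem_factors {R : List (List (List Γ))} {x : List Γ} (h : x ∈ factors R) :
    ∃ a b c, a ++ b ++ c ∈ R ∧ b.flatten = x := by
  simp only [factors, List.mem_flatMap, List.mem_map, List.mem_range] at h
  obtain ⟨r, hr, i, -, j, -, rfl⟩ := h
  refine ⟨(r.take j).take i, seg r i j, r.drop j, ?_, rfl⟩
  unfold seg
  rwa [List.take_append_drop, List.take_append_drop]

theorem mem_factors_of_derives {R : List (List (List Γ))} {x : List Γ} (h : Derives R x) :
    x ∈ factors R := by
  obtain ⟨r, hr, rfl⟩ := h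
  exact mem_factors_of_append (a := []) (c := []) (by simpa using hr)

theorem exists_middle_flatten (w : Γ → ℕ) (l : List (List Γ)) (hl : l ≠ []) :
    ∃ l₁ x l₂, l = l₁ ++ x :: l₂ ∧ 2 * wstr w l₁.flatten ≤ wstr w l.flatten ∧
      2 * wstr w l₂.flatten ≤ wstr w l.flatten := by
  obtain ⟨l₁, x, l₂, h, h₁, h₂⟩ := exists_middle (wstr w) (wstr w l.flatten) l 0 hl (by simp)
    (by rw [wstr_flatten]; simp)
  refine ⟨l₁, x, l₂, h, ?_, ?_⟩
  · rw [wstr_flatten w l₁]; simpa using h₁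
  · rw [wstr_flatten w l₂]; exact h₂

theorem Sound.splits_three {w : Γ → ℕ} {R : List (List (List Γ))} (hR : Sound w R)
    {x : List Γ} (hx : Derives R x) : Splits w (factors R) 3 x := by
  obtain ⟨r, hr, rfl⟩ := hx
  rcases eq_or_ne r [] with rfl | hne
  · exact ⟨[], by simp, rfl, by simp⟩
  obtain ⟨l₁, y, l₂, rfl, h₁, h₂⟩ := exists_middle_flatten w r hne
  refine ⟨[l₁.flatten, y, l₂.flatten], by simp, by simp, ?_⟩
  intro z hz
  simp only [List.mem_cons, List.not_mem_nil, or_false] at hz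
  rcases hz with rfl | rfl | rfl
  · exact Or.inr (Or.inr ⟨mem_factors_of_append (a := []) (c := y :: l₂) (by simpa using hr), h₁⟩)
  · rcases hR _ hr z (by simp) with h | h | ⟨h, h'⟩
    · exact Or.inl h
    · exact Or.inr (Or.inl h)
    · exact Or.inr (Or.inr ⟨mem_factors_of_derives h, h'⟩)
  · exact Or.inr (Or.inr ⟨mem_factors_of_append (a := l₁ ++ [y]) (c := []) (by simpa using hr), h₂⟩)

theorem Sound.splits_five {w : Γ → ℕ} {R : List (List (List Γ))} (hR : Sound w R)
    {x : List Γ} (hx : x ∈ factors R) : Splits w (factors R) 5 x := by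
  obtain ⟨a, b, c, hr, rfl⟩ := exists_of_mem_factors hx
  rcases eq_or_ne b [] with rfl | hne
  · exact ⟨[], by simp, rfl, by simp⟩
  obtain ⟨l₁, y, l₂, rfl, h₁, h₂⟩ := exists_middle_flatten w b hne
  have hy : Splits w (factors R) 3 y := by
    rcases hR _ hr y (by simp) with h | h | ⟨h, -⟩
    · exact ⟨[y], by simp, by simp, by simp [h]⟩
    · exact ⟨[y], by simp, by simp, by simp [h]⟩
    · exact hR.splits_three h
  obtain ⟨m, hm, hmy, hmp⟩ := hy
  have hle : wstr w y ≤ wstr w (l₁ ++ y :: l₂).flatten := by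
    simp only [List.flatten_append, List.flatten_cons, wstr_append]
    omega
  refine ⟨l₁.flatten :: (m ++ [l₂.flatten]), by simp; omega, by simp [hmy], ?_⟩
  intro z hz
  simp only [List.mem_cons, List.mem_append, List.not_mem_nil, or_false] at hz
  rcases hz with rfl | hz | rfl
  · exact Or.inr (Or.inr ⟨mem_factors_of_append (a := a) (c := y :: l₂ ++ c)
      (by simpa using hr), h₁⟩)
  · rcases hmp z hz with h | h | ⟨h, h'⟩
    · exact Or.inl h
    · exact Or.inr (Or.inl h)
    · exact Or.inr (Or.inr ⟨h, h'.trans hle⟩)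
  · exact Or.inr (Or.inr ⟨mem_factors_of_append (a := a ++ l₁ ++ [y]) (c := c)
      (by simpa using hr), h₂⟩)

theorem wstr_pos {w : Γ → ℕ} (hw : ∀ a, 0 < w a) {s : List Γ} (hs : s ≠ []) : 0 < wstr w s := by
  cases s with
  | nil => exact absurd rfl hs
  | cons a t =>
    have := hw a
    simp only [wstr, List.map_cons, List.sum_cons]
    omega

/-- The string a symbol stands for, when variables are strings. -/
def symStr {F : List (List Γ)} : {u // u ∈ F} ⊕ Γ → List Γ
  | Sum.inl v => v.1
  | Sum.inr a => [a]

theorem exists_symbols (w : Γ → ℕ) (F : List (List Γ)) (n : ℕ) (l : List (List Γ))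
    (h : ∀ y ∈ l, y = [] ∨ y.length = 1 ∨ (y ∈ F ∧ 2 * wstr w y ≤ n)) :
    ∃ l' : List ({u // u ∈ F} ⊕ Γ), l'.length ≤ l.length ∧
      (l'.map symStr).flatten = l.flatten ∧
      ∀ v, Sum.inl v ∈ l' → v.1 ≠ [] ∧ 2 * wstr w v.1 ≤ n := by
  induction l with
  | nil => exact ⟨[], by simp, rfl, by simp⟩
  | cons y t ih =>
    obtain ⟨l', h₁, h₂, h₃⟩ := ih fun z hz => h z (List.mem_cons_of_mem _ hz)
    rcases eq_or_ne y [] with rfl | hy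
    · exact ⟨l', by simp; omega, by simpa using h₂, h₃⟩
    rcases h y List.mem_cons_self with h | h | ⟨h, h'⟩
    · exact absurd h hy
    · obtain ⟨a, rfl⟩ := List.length_eq_one_iff.1 h
      exact ⟨Sum.inr a :: l', by simpa using h₁, by simp [symStr, h₂], by simpa using h₃⟩
    · refine ⟨Sum.inl ⟨y, h⟩ :: l', by simpa using h₁, by simp [symStr, h₂], ?_⟩
      intro v hv
      rcases List.mem_cons.1 hv with hv | hv
      · cases hv
        exact ⟨hy, h'⟩
      · exact h₃ v hv

/-- A family of strings closed under contracting splittings yields a contracting SLP. -/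
theorem exists_slp_of_splits {w : Γ → ℕ} (hw : ∀ a, 0 < w a) (F : List (List Γ)) (hF : F ≠ [])
    (k : ℕ) (h : ∀ x ∈ F, Splits w F k x) :
    ∃ (V : Type) (_ : Fintype V) (G : SLP V Γ), Fintype.card V ≤ F.length ∧
      (∀ A, (G.rhs A).length ≤ k) ∧ G.Contracting w ∧ ∀ x ∈ F, G.defines x := by
  classical
  have hsym : ∀ A : {u // u ∈ F}, ∃ l' : List ({u // u ∈ F} ⊕ Γ), l'.length ≤ k ∧
      (l'.map symStr).flatten = A.1 ∧
      ∀ v, Sum.inl v ∈ l' → v.1 ≠ [] ∧ 2 * wstr w v.1 ≤ wstr w A.1 := by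
    intro A
    obtain ⟨l, h₁, h₂, h₃⟩ := h A.1 A.2
    obtain ⟨l', h₁', h₂', h₃'⟩ := exists_symbols w F _ l h₃
    exact ⟨l', h₁'.trans h₁, h₂'.trans h₂, h₃'⟩
  choose rhs h₁ h₂ h₃ using hsym
  let G : SLP {u // u ∈ F} Γ :=
    { rhs := rhs
      rank := fun A => wstr w A.1
      rank_lt := by
        intro A B hB
        obtain ⟨hne, hle⟩ := h₃ A B hB
        have := wstr_pos hw hne
        omega
      start := ⟨F.head hF, List.head_mem hF⟩ }
  have hval : ∀ n, ∀ A : {u // u ∈ F}, wstr w A.1 = n → G.val A = A.1 := by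
    intro n
    induction n using Nat.strong_induction_on with
    | _ n ih =>
      rintro A rfl
      rw [SLP.val]
      refine Eq.trans ?_ (h₂ A)
      congr 1
      conv_rhs => rw [← List.attach_map_subtype_val (rhs A), List.map_map]
      refine List.map_congr_left ?_
      rintro ⟨β, hβ⟩ -
      rcases β with B | a
      · exact ih _ (G.rank_lt A B hβ) B rfl
      · rfl
  refine ⟨{u // u ∈ F}, inferInstance, G, ?_, h₁, ?_, fun x hx => ⟨⟨x, hx⟩, hval _ _ rfl⟩⟩
  · calc Fintype.card {u // u ∈ F} = Fintype.card {u // u ∈ F.toFinset} :=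
          Fintype.card_congr (Equiv.subtypeEquivRight fun x => by simp)
      _ = F.toFinset.card := Fintype.card_coe _
      _ ≤ F.length := F.toFinset_card_le
  · intro A B hB
    unfold SLP.wval
    rw [hval _ A rfl, hval _ B rfl]
    exact (h₃ A B hB).2

/-- Splitting at middle letters recursively yields a tree on the positions of `s` (with parent
map `p`, depth `dep` and a bound `e` on the descendants) in which the factor between `p b`
and `b` is at least as heavy as the factor between `b` and any descendant. -/
theorem exists_position_tree (w : Γ → ℕ) : ∀ (n : ℕ) (s : List Γ), s.length ≤ n →
    ∃ (R : List (List (List Γ))) (p e dep : ℕ → ℕ), Sound w R ∧ cost R ≤ 41 * s.length ∧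
      (s = [] ∨ ∃ r ∈ R, r.flatten = s ∧ r.length ≤ 3) ∧ dep 0 = 0 ∧
      ∀ b, 0 < b → b ≤ s.length → p b < b ∧ b ≤ e b ∧ e b ≤ s.length ∧
        dep b = dep (p b) + 1 ∧ (0 < p b → e b ≤ e (p b)) ∧
        wstr w (seg s b (e b)) ≤ wstr w (seg s (p b) b) ∧
        ∃ r ∈ R, r.flatten = seg s (p b) b ∧ r.length ≤ 4 := by
  intro n
  induction n with
  | zero =>
    intro s hs
    have : s = [] := List.length_eq_zero_iff.1 (by omega)
    subst this
    exact ⟨[], id, id, fun _ => 0, by simp [Sound], by simp [cost], Or.inl rfl, rfl,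
      fun b h h' => absurd h' (by simp; omega)⟩
  | succ n ih =>
    intro s hs
    rcases eq_or_ne s [] with rfl | hne
    · exact ih [] (by simp)
    obtain ⟨L, m, M, rfl, hL, hM⟩ := exists_middle w (wstr w s) s 0 hne (by simp) (by simp [wstr])
    rw [Nat.zero_add] at hL
    change 2 * wstr w L ≤ _ at hL
    change 2 * wstr w M ≤ _ at hM
    set s := L ++ m :: M with hs_def
    have hlen : s.length = L.length + 1 + M.length := by simp [hs_def]; omega
    have hsM : s = (L ++ [m]) ++ M := by simp [hs_def]
    have hwt : wstr w s = wstr w L + w m + wstr w M := by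
      rw [hsM, wstr_append, wstr_append]; simp [wstr]
    have hsegL : ∀ a b, b ≤ L.length → seg s a b = seg L a b := fun a b hb =>
      seg_append_left _ _ hb
    have hsegM : ∀ a b, seg s (L.length + 1 + a) (L.length + 1 + b) = seg M a b := by
      intro a b
      have := seg_append_right (L ++ [m]) M a b
      rw [← hsM] at this
      simpa using this
    have hseg0 : seg s 0 (L.length + 1) = L ++ [m] := by
      rw [seg_zero, hsM]
      exact List.take_left' (by simp)
    obtain ⟨RL, pL, eL, dL, hRL, hcL, hrL, hd0L, hL'⟩ := ih L (by omega)
    obtain ⟨RM, pM, eM, dM, hRM, hcM, hrM, hd0M, hM'⟩ := ih M (by omega)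
    obtain ⟨rL, hrLf, hrLl, hrLp⟩ : ∃ rL : List (List Γ), rL.flatten = L ∧ rL.length ≤ 3 ∧
        ∀ x ∈ rL, Piece w RL (wstr w L) x := by
      rcases hrL with rfl | ⟨r, hr, hrf, hrl⟩
      · exact ⟨[], rfl, by simp, by simp⟩
      · exact ⟨r, hrf, hrl, fun x hx => by simpa [hrf] using hRL r hr x hx⟩
    have hsubL : ∀ r ∈ RL, r ∈ RL ++ RM := fun r hr => List.mem_append_left _ hr
    have hsubM : ∀ r ∈ RM, r ∈ RL ++ RM := fun r hr => List.mem_append_right _ hr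
    have hLM : Sound w (RL ++ RM) := by
      intro r hr x hx
      rcases List.mem_append.1 hr with hr | hr
      · exact (hRL r hr x hx).mono hsubL le_rfl
      · exact (hRM r hr x hx).mono hsubM le_rfl
    have hPL : Piece w (RL ++ RM) (wstr w s) L := by
      rcases hrL with h | ⟨r, hr, hrf, -⟩
      · exact Or.inl h
      · exact Or.inr (Or.inr ⟨⟨r, hsubL r hr, hrf⟩, hL⟩)
    have hPM : Piece w (RL ++ RM) (wstr w s) M := by
      rcases hrM with h | ⟨r, hr, hrf, -⟩
      · exact Or.inl h
      · exact Or.inr (Or.inr ⟨⟨r, hsubM r hr, hrf⟩, hM⟩)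
    have hmem : ∀ r ∈ RL ++ RM, r ∈ [[L, [m], M], rL ++ [[m]]] ++ (RL ++ RM) :=
      fun r hr => List.mem_append_right _ hr
    refine ⟨[[L, [m], M], rL ++ [[m]]] ++ (RL ++ RM),
      fun b => if b ≤ L.length then pL b else if b = L.length + 1 then 0 else
        L.length + 1 + pM (b - (L.length + 1)),
      fun b => if b ≤ L.length then eL b else if b = L.length + 1 then L.length + 1 + M.length else
        L.length + 1 + eM (b - (L.length + 1)),
      fun b => if b ≤ L.length then dL b else dM (b - (L.length + 1)) + 1, ?_, ?_, ?_, ?_, ?_⟩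
    · refine hLM.append ?_
      intro r hr x hx
      simp only [List.mem_cons, List.not_mem_nil, or_false] at hr
      rcases hr with rfl | rfl
      · have hf : [L, [m], M].flatten = s := by simp [hs_def]
        rw [hf]
        simp only [List.mem_cons, List.not_mem_nil, or_false] at hx
        rcases hx with rfl | rfl | rfl
        · exact hPL
        · exact Or.inr (Or.inl rfl)
        · exact hPM
      · rcases List.mem_append.1 hx with hx | hx
        · refine (hrLp x hx).mono hsubL ?_
          rw [List.flatten_append, wstr_append, hrLf]
          omega
        · rw [List.mem_singleton] at hx
          exact Or.inr (Or.inl (by simp [hx]))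
    · rw [cost_append, cost_append]
      have : cost [[L, [m], M], rL ++ [[m]]] ≤ 41 := by
        have h : (rL.length + 1 + 1) ^ 2 ≤ 5 ^ 2 := Nat.pow_le_pow_left (by omega) 2
        simp [cost]
        omega
      omega
    · exact Or.inr ⟨[L, [m], M], by simp, by simp [hs_def], by simp⟩
    · simp [hd0L]
    · intro b hb hbs
      beta_reduce
      rcases lt_trichotomy b (L.length + 1) with hlt | heq | hgt
      · have hbL : b ≤ L.length := by omega
        obtain ⟨h₁, h₂, h₃, h₄, h₅, h₆, r, hr, hrf, hrl⟩ := hL' b hb hbL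
        have hpL : pL b ≤ L.length := by omega
        rw [if_pos hbL, if_pos hbL, if_pos hbL, if_pos hpL, if_pos hpL, hsegL _ _ hbL,
          hsegL _ _ h₃]
        exact ⟨h₁, h₂, by omega, h₄, h₅, h₆, r, hmem _ (hsubL r hr), hrf, hrl⟩
      · subst heq
        have hnot : ¬ L.length + 1 ≤ L.length := by omega
        rw [if_neg hnot, if_neg hnot, if_neg hnot, if_pos rfl, if_pos rfl,
          if_pos (Nat.zero_le _), if_pos (Nat.zero_le _)]
        have hseg1 : seg s (L.length + 1) (L.length + 1 + M.length) = M := by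
          have := hsegM 0 M.length
          rw [Nat.add_zero, seg_zero] at this
          simpa using this
        rw [hseg1, hseg0]
        refine ⟨by omega, by omega, by omega, by simp [hd0L, hd0M], by simp, ?_,
          rL ++ [[m]], by simp, by simp [hrLf], by simp; omega⟩
        have : wstr w (L ++ [m]) = wstr w L + w m := by rw [wstr_append]; simp [wstr]
        omega
      · obtain ⟨c, rfl⟩ : ∃ c, b = L.length + 1 + c := ⟨b - (L.length + 1), by omega⟩
        have hc : 0 < c := by omega
        obtain ⟨h₁, h₂, h₃, h₄, h₅, h₆, r, hr, hrf, hrl⟩ := hM' c hc (by omega)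
        have hnot : ∀ d, ¬ L.length + 1 + d ≤ L.length := fun d => by omega
        have hne' : ¬ L.length + 1 + c = L.length + 1 := by omega
        simp only [if_neg (hnot _), if_neg hne', Nat.add_sub_cancel_left]
        rw [hsegM, hsegM]
        refine ⟨by omega, by omega, by omega, by omega, ?_, h₆, r, hmem _ (hsubM r hr), hrf, hrl⟩
        intro _
        split_ifs with h
        · omega
        · have := h₅ (by omega)
          omega

/-- Iterating the parent map of a forest. -/
theorem iterate_parent {N : Finset ℕ} {q e dep : ℕ → ℕ}
    (hq : ∀ b ∈ N, q b ≤ b ∧ dep b = dep (q b) + 1 ∧ (q b ∈ N ∨ dep (q b) = 0) ∧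
      (q b ∈ N → e b ≤ e (q b))) {b : ℕ} (hb : b ∈ N) (k : ℕ) (hk : k < dep b) :
    q^[k] b ∈ N ∧ dep (q^[k] b) + k = dep b ∧ q^[k] b ≤ b ∧ e b ≤ e (q^[k] b) := by
  induction k with
  | zero => exact ⟨hb, rfl, le_rfl, le_rfl⟩
  | succ k ih =>
    obtain ⟨h₁, h₂, h₃, h₄⟩ := ih (by omega)
    obtain ⟨g₁, g₂, g₃, g₄⟩ := hq _ h₁
    rw [Function.iterate_succ_apply']
    have hN : q (q^[k] b) ∈ N := by
      rcases g₃ with h | h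
      · exact h
      · omega
    have := g₄ hN
    exact ⟨hN, by omega, by omega, by omega⟩

/-- All root paths of a forest with linearly many rules: the paths without their first edge are
obtained from the forest in which pairs of consecutive edges are contracted. -/
theorem exists_root_paths (w : Γ → ℕ) (s : List Γ) : ∀ (n : ℕ) (N : Finset ℕ), N.card ≤ n →
    ∀ (q e dep : ℕ → ℕ) (ℓ : ℕ) (R : List (List (List Γ))), Sound w R →
    (∀ b ∈ N, q b ≤ b ∧ dep b = dep (q b) + 1 ∧ (q b ∈ N ∨ dep (q b) = 0) ∧
      (q b ∈ N → e b ≤ e (q b))) →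
    (∀ b ∈ N, b ≤ e b ∧ wstr w (seg s b (e b)) ≤ wstr w (seg s (q b) b)) →
    (∀ b ∈ N, ∃ r ∈ R, r.flatten = seg s (q b) b ∧ r.length ≤ ℓ) →
    ∃ R', Sound w (R' ++ R) ∧ cost R' ≤ 8 * (ℓ + 4) ^ 2 * N.card ∧
      ∀ b ∈ N, Derives (R' ++ R) (seg s (q^[dep b] b) b) := by
  classical
  intro n
  induction n with
  | zero =>
    intro N hN q e dep ℓ R hR _ _ _
    have : N = ∅ := Finset.card_eq_zero.1 (by omega)
    subst this
    exact ⟨[], by simpa using hR, by simp [cost], by simp⟩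
  | succ n ih =>
    intro N hN q e dep ℓ R hR hq he hr
    rcases N.eq_empty_or_nonempty with rfl | hne
    · exact ⟨[], by simpa using hR, by simp [cost], by simp⟩
    choose! rule hrule hflat hlen using hr
    have hiter := fun {b} (hb : b ∈ N) => iterate_parent hq hb
    have hdom : ∀ b ∈ N, ∀ c, b ≤ c → c ≤ e b →
        wstr w (seg s b c) ≤ wstr w (seg s (q b) b) := by
      intro b hb c hbc hce
      have := wstr_seg_add w s hbc hce
      have := (he b hb).2
      omega
    set N₁ := N.filter fun b => dep b % 2 = 1 ∧ 3 ≤ dep b ∧ ∃ c ∈ N, q c = b with hN₁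
    have hN₁N : ∀ b ∈ N₁, b ∈ N := fun b hb => (Finset.mem_filter.1 hb).1
    have hpar : ∀ b ∈ N₁, q b ∈ N ∧ q (q b) ∈ N ∧ dep b = dep (q (q b)) + 2 := by
      intro b hb
      obtain ⟨hbN, -, h3, -⟩ := Finset.mem_filter.1 hb
      have h1 := hiter hbN 1 (by omega)
      have h2 := hiter hbN 2 (by omega)
      exact ⟨h1.1, h2.1, h2.2.1.symm⟩
    have hcard : 2 * N₁.card ≤ N.card := by
      have hchild : ∀ b ∈ N₁, ∃ c ∈ N, q c = b := fun b hb => (Finset.mem_filter.1 hb).2.2.2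
      choose! ch hch hqch using hchild
      have hinj : Set.InjOn ch N₁ := by
        intro a ha b hb hab
        rw [← hqch a ha, ← hqch b hb, hab]
      have hdisj : Disjoint N₁ (N₁.image ch) := by
        rw [Finset.disjoint_left]
        intro a ha ha'
        obtain ⟨b, hb, rfl⟩ := Finset.mem_image.1 ha'
        have h1 := (Finset.mem_filter.1 ha).2.1
        have h2 := (Finset.mem_filter.1 hb).2.1
        have h3 := (hq _ (hch b hb)).2.1
        rw [hqch b hb] at h3
        omega
      have hsub : N₁ ∪ N₁.image ch ⊆ N := by
        intro a ha
        rcases Finset.mem_union.1 ha with ha | ha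
        · exact hN₁N a ha
        · obtain ⟨b, hb, rfl⟩ := Finset.mem_image.1 ha
          exact hch b hb
      have := Finset.card_le_card hsub
      rw [Finset.card_union_of_disjoint hdisj, Finset.card_image_of_injOn hinj] at this
      omega
    have hpos : 0 < N.card := hne.card_pos
    set R₁ := N₁.toList.map fun b => rule (q b) ++ [seg s (q b) b] with hR₁
    have hflat₁ : ∀ b ∈ N₁, (rule (q b) ++ [seg s (q b) b]).flatten = seg s (q (q b)) b := by
      intro b hb
      obtain ⟨h1, h2, -⟩ := hpar b hb
      rw [List.flatten_append, hflat _ h1, List.flatten_singleton,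
        seg_append_seg s (hq _ h1).1 (hq _ (hN₁N b hb)).1]
    have hS₁ : Sound w (R₁ ++ R) := by
      refine hR.append ?_
      intro r hr x hx
      obtain ⟨b, hb, rfl⟩ := List.mem_map.1 hr
      rw [Finset.mem_toList] at hb
      obtain ⟨h1, h2, -⟩ := hpar b hb
      have hbN := hN₁N b hb
      have hsum := wstr_seg_add w s (hq _ h1).1 (hq _ hbN).1
      rw [hflat₁ b hb]
      rcases List.mem_append.1 hx with hx | hx
      · refine (hR _ (hrule _ h1) x hx).mono (fun _ h => h) ?_
        rw [hflat _ h1]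
        omega
      · rw [List.mem_singleton] at hx
        subst hx
        refine Or.inr (Or.inr ⟨⟨_, hrule b hbN, hflat b hbN⟩, ?_⟩)
        have := hdom _ h1 b (hq _ hbN).1 ((he b hbN).1.trans ((hq _ hbN).2.2.2 h1))
        omega
    obtain ⟨R₂, hS₂, hc₂, hd₂⟩ := ih N₁ (by omega) (fun b => q (q b)) e (fun b => (dep b - 1) / 2)
      (ℓ + 1) (R₁ ++ R) hS₁
      (by
        intro b hb
        have hb' := Finset.mem_filter.1 hb
        obtain ⟨h1, h2, h3⟩ := hpar b hb
        have hbN := hN₁N b hb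
        have := (hq _ hbN).1
        have := (hq _ h1).1
        refine ⟨by omega, by omega, ?_, fun _ => ((hq _ hbN).2.2.2 h1).trans ((hq _ h1).2.2.2 h2)⟩
        by_cases h : 3 ≤ dep (q (q b))
        · exact Or.inl (Finset.mem_filter.2 ⟨h2, by omega, h, q b, h1, rfl⟩)
        · exact Or.inr (by omega))
      (by
        intro b hb
        obtain ⟨h1, h2, h3⟩ := hpar b hb
        have hbN := hN₁N b hb
        have hsum := wstr_seg_add w s (hq _ h1).1 (hq _ hbN).1
        have := (he b hbN).2
        exact ⟨(he b hbN).1, by omega⟩)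
      (by
        intro b hb
        have := hlen _ (hpar b hb).1
        exact ⟨_, List.mem_append_left _ (List.mem_map.2 ⟨b, Finset.mem_toList.2 hb, rfl⟩),
          hflat₁ b hb, by simp; omega⟩)
    set top : ℕ → ℕ := fun b => q^[dep b - 1] b with htop
    set mid : ℕ → ℕ := fun b => if dep b % 2 = 0 then q b else q (q b) with hmid
    set path : ℕ → List (List Γ) := fun b =>
      rule (top b) ++ [seg s (top b) (mid b), seg s (mid b) (q b), seg s (q b) b] with hpath
    set N₃ := N.filter fun b => 2 ≤ dep b with hN₃
    set R₃ := N₃.toList.map path with hR₃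
    have hroot : ∀ b ∈ N, q^[dep b] b = q (top b) := by
      intro b hb
      have := (hq b hb).2.1
      rw [htop, ← Function.iterate_succ_apply' q]
      congr 2
      omega
    have htopN : ∀ b ∈ N, top b ∈ N ∧ top b ≤ b ∧ e b ≤ e (top b) := by
      intro b hb
      have := (hq b hb).2.1
      obtain ⟨h1, -, h2, h3⟩ := hiter hb (dep b - 1) (by omega)
      exact ⟨h1, h2, h3⟩
    have hmidle : ∀ b ∈ N₃, mid b ≤ q b ∧ q b ∈ N ∧ q b ≤ b ∧ top b ≤ mid b ∧
        (seg s (mid b) (q b) = [] ∨ Derives R (seg s (mid b) (q b))) ∧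
        (seg s (top b) (mid b) = [] ∨ Derives (R₂ ++ (R₁ ++ R)) (seg s (top b) (mid b))) := by
      intro b hb
      obtain ⟨hbN, h2⟩ := Finset.mem_filter.1 hb
      have h1 := hiter hbN 1 (by omega)
      simp only [Function.iterate_one] at h1
      have key : ∀ c ∈ N, dep c % 2 = 1 → (∃ d ∈ N, q d = c) → top c ≤ c ∧
          (seg s (top c) c = [] ∨ Derives (R₂ ++ (R₁ ++ R)) (seg s (top c) c)) := by
        intro c hc hodd hch
        refine ⟨(htopN c hc).2.1, ?_⟩
        by_cases h3 : 3 ≤ dep c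
        · right
          have := hd₂ c (Finset.mem_filter.2 ⟨hc, hodd, h3, hch⟩)
          have heq : (fun b => q (q b))^[(dep c - 1) / 2] c = top c := by
            change (q^[2])^[(dep c - 1) / 2] c = q^[dep c - 1] c
            rw [← Function.iterate_mul]
            congr 2
            omega
          rwa [heq] at this
        · left
          have h : dep c - 1 = 0 := by omega
          simp only [htop, h, Function.iterate_zero, id_eq, seg_self]
      by_cases hpar' : dep b % 2 = 0
      · have hm : mid b = q b := if_pos hpar'
        have ht : top b = top (q b) := by
          simp only [htop]
          rw [← Function.iterate_succ_apply q]
          congr 2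
          omega
        obtain ⟨k1, k2⟩ := key (q b) h1.1 (by omega) ⟨b, hbN, rfl⟩
        rw [hm, ht]
        exact ⟨le_rfl, h1.1, h1.2.2.1, k1, Or.inl (seg_self _ _), k2⟩
      · have hm : mid b = q (q b) := if_neg hpar'
        have h2' := hiter hbN 2 (by omega)
        change q (q b) ∈ N ∧ dep (q (q b)) + 2 = dep b ∧ _ at h2'
        have ht : top b = top (q (q b)) := by
          simp only [htop]
          rw [← Function.iterate_succ_apply q, ← Function.iterate_succ_apply q]
          congr 2
          omega
        obtain ⟨k1, k2⟩ := key (q (q b)) h2'.1 (by omega) ⟨q b, h1.1, rfl⟩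
        rw [hm, ht]
        exact ⟨(hq _ h1.1).1, h1.1, h1.2.2.1, k1,
          Or.inr ⟨_, hrule _ h1.1, hflat _ h1.1⟩, k2⟩
    have hflat₃ : ∀ b ∈ N₃, (path b).flatten = seg s (q (top b)) b := by
      intro b hb
      have hbN := (Finset.mem_filter.1 hb).1
      obtain ⟨h1, h2, h3, h4, -, -⟩ := hmidle b hb
      obtain ⟨t1, t2, -⟩ := htopN b hbN
      simp only [hpath, List.flatten_append, List.flatten_cons, List.flatten_nil,
        List.append_nil, hflat _ t1]
      rw [seg_append_seg s h1 h3, seg_append_seg s h4 (h1.trans h3),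
        seg_append_seg s (hq _ t1).1 t2]
    have hsub : ∀ r ∈ R, r ∈ R₂ ++ (R₁ ++ R) := fun r hr =>
      List.mem_append_right _ (List.mem_append_right _ hr)
    have hS₃ : Sound w (R₃ ++ (R₂ ++ (R₁ ++ R))) := by
      refine hS₂.append ?_
      intro r hr x hx
      obtain ⟨b, hb, rfl⟩ := List.mem_map.1 hr
      rw [Finset.mem_toList] at hb
      have hbN := (Finset.mem_filter.1 hb).1
      obtain ⟨h1, h2, h3, h4, h5, h6⟩ := hmidle b hb
      obtain ⟨t1, t2, t3⟩ := htopN b hbN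
      have d1 := hdom _ t1 b t2 ((he b hbN).1.trans t3)
      have w1 := wstr_seg_add w s (hq _ t1).1 t2
      have w2 := wstr_seg_add w s h4 (h1.trans h3)
      have w3 := wstr_seg_add w s h1 h3
      rw [hflat₃ b hb]
      rcases List.mem_append.1 hx with hx | hx
      · refine (hR _ (hrule _ t1) x hx).mono hsub ?_
        rw [hflat _ t1]
        omega
      · simp only [List.mem_cons, List.not_mem_nil, or_false] at hx
        rcases hx with rfl | rfl | rfl
        · rcases h6 with h | h
          · exact Or.inl h
          · exact Or.inr (Or.inr ⟨h, by omega⟩)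
        · rcases h5 with h | h
          · exact Or.inl h
          · exact Or.inr (Or.inr ⟨h.mono hsub, by omega⟩)
        · exact Or.inr (Or.inr ⟨⟨_, hsub _ (hrule b hbN), hflat b hbN⟩, by omega⟩)
    refine ⟨R₃ ++ (R₂ ++ R₁), by simpa using hS₃, ?_, ?_⟩
    · rw [cost_append, cost_append]
      have c1 : cost R₁ ≤ N₁.card * (ℓ + 1 + 1) ^ 2 := by
        refine (cost_map_le _ _ (ℓ + 1) ?_).trans (by simp)
        intro b hb
        have := hlen _ (hpar b (Finset.mem_toList.1 hb)).1
        simp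
        omega
      have c3 : cost R₃ ≤ N.card * (ℓ + 3 + 1) ^ 2 := by
        refine (cost_map_le _ _ (ℓ + 3) ?_).trans ?_
        · intro b hb
          have hbN := (Finset.mem_filter.1 (Finset.mem_toList.1 hb)).1
          have := hlen _ (htopN b hbN).1
          simp [hpath]
          omega
        · rw [Finset.length_toList]
          exact Nat.mul_le_mul_right _ (Finset.card_filter_le _ _)
      have c4 : 2 * (cost R₂ + cost R₁) ≤ N.card * (8 * (ℓ + 5) ^ 2 + (ℓ + 2) ^ 2) := by
        calc 2 * (cost R₂ + cost R₁) ≤ 2 * N₁.card * (8 * (ℓ + 5) ^ 2 + (ℓ + 2) ^ 2) := by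
              have e1 : 8 * (ℓ + 1 + 4) ^ 2 * N₁.card = N₁.card * (8 * (ℓ + 5) ^ 2) := by ring
              have e2 : N₁.card * (ℓ + 1 + 1) ^ 2 = N₁.card * (ℓ + 2) ^ 2 := by ring
              have e3 : 2 * N₁.card * (8 * (ℓ + 5) ^ 2 + (ℓ + 2) ^ 2) =
                2 * (N₁.card * (8 * (ℓ + 5) ^ 2) + N₁.card * (ℓ + 2) ^ 2) := by ring
              omega
          _ ≤ _ := Nat.mul_le_mul_right _ hcard
      have c5 : N.card * (2 * (ℓ + 3 + 1) ^ 2 + (8 * (ℓ + 5) ^ 2 + (ℓ + 2) ^ 2)) ≤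
          N.card * (16 * (ℓ + 4) ^ 2) :=
            Nat.mul_le_mul_left _ (Nat.le.intro (k := 5 * ℓ ^ 2 + 28 * ℓ + 20) (by ring))
      have e4 : 2 * (8 * (ℓ + 4) ^ 2 * N.card) = N.card * (16 * (ℓ + 4) ^ 2) := by ring
      rw [Nat.mul_add] at c5
      have e5 : N.card * (2 * (ℓ + 3 + 1) ^ 2) = 2 * (N.card * (ℓ + 3 + 1) ^ 2) := by ring
      omega
    · intro b hb
      rw [hroot b hb]
      by_cases h2 : 2 ≤ dep b
      · have hb₃ : b ∈ N₃ := Finset.mem_filter.2 ⟨hb, h2⟩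
        exact ⟨path b, List.mem_append_left _ (List.mem_append_left _
          (List.mem_map.2 ⟨b, Finset.mem_toList.2 hb₃, rfl⟩)), hflat₃ b hb₃⟩
      · have h : dep b - 1 = 0 := by omega
        have ht : top b = b := by simp only [htop, h, Function.iterate_zero, id_eq]
        rw [ht]
        exact ⟨rule b, List.mem_append_right _ (hrule b hb), hflat b hb⟩

/-- Linearly many contracting rules derive all nonempty prefixes. -/
theorem exists_prefix_rules (w : Γ → ℕ) (s : List Γ) :
    ∃ R, Sound w R ∧ cost R ≤ 553 * s.length ∧
      ∀ k, 1 ≤ k → k ≤ s.length → Derives R (s.take k) := by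
  obtain ⟨R, p, e, dep, hR, hc, -, hd0, h⟩ := exists_position_tree w s.length s le_rfl
  have hmem : ∀ {b}, b ∈ Finset.Icc 1 s.length → 0 < b ∧ b ≤ s.length := fun hb => by
    simpa [Nat.succ_le_iff] using hb
  have hq : ∀ b ∈ Finset.Icc 1 s.length, p b ≤ b ∧ dep b = dep (p b) + 1 ∧
      (p b ∈ Finset.Icc 1 s.length ∨ dep (p b) = 0) ∧
      (p b ∈ Finset.Icc 1 s.length → e b ≤ e (p b)) := by
    intro b hb
    obtain ⟨h₁, h₂, h₃, h₄, h₅, -, -⟩ := h b (hmem hb).1 (hmem hb).2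
    refine ⟨h₁.le, h₄, ?_, fun hp => h₅ (hmem hp).1⟩
    rcases Nat.eq_zero_or_pos (p b) with h0 | h0
    · exact Or.inr (by rw [h0, hd0])
    · exact Or.inl (Finset.mem_Icc.2 ⟨h0, by have := (hmem hb).2; omega⟩)
  obtain ⟨R', hS, hc', hD⟩ := exists_root_paths w s _ (Finset.Icc 1 s.length) le_rfl p e dep 4 R hR
    hq
    (fun b hb => by
      obtain ⟨h₁, h₂, h₃, h₄, h₅, h₆, -⟩ := h b (hmem hb).1 (hmem hb).2
      exact ⟨h₂, h₆⟩)
    (fun b hb => by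
      obtain ⟨h₁, h₂, h₃, h₄, h₅, h₆, h₇⟩ := h b (hmem hb).1 (hmem hb).2
      exact h₇)
  refine ⟨R' ++ R, hS, ?_, ?_⟩
  · rw [cost_append]
    simp only [Nat.card_Icc, Nat.add_sub_cancel] at hc'
    omega
  · intro k hk hks
    have hkN : k ∈ Finset.Icc 1 s.length := Finset.mem_Icc.2 ⟨hk, hks⟩
    have hroot : p^[dep k] k = 0 := by
      have h1 := (hq k hkN).2.1
      obtain ⟨g₁, g₂, -, -⟩ := iterate_parent hq hkN (dep k - 1) (by omega)
      have h2 := hq _ g₁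
      have h3 : dep k = (dep k - 1) + 1 := by omega
      rw [h3, Function.iterate_succ_apply']
      by_contra hne
      have hlt := h _ (hmem g₁).1 (hmem g₁).2
      have h4 := h (p (p^[dep k - 1] k)) (Nat.pos_of_ne_zero hne)
        (by have := (hmem g₁).2; omega)
      omega
    have := hD k hkN
    rwa [hroot, seg_zero] at this

end ContractingSLP

/-- There is a constant `c` such that for every weighted string `s`
of length `n ≥ 1` over a weighted alphabet `Γ` there is a contracting SLP over `Γ`
with at most `c·n` variables whose right-hand sides have length at most `10`
and which defines all nonempty prefixes of `s`. -/
theorem contracting_prefix_slp :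
    ∃ c : ℕ,
      ∀ (Γ : Type) (instΓ : Fintype Γ) (w : Γ → ℕ), (∀ a : Γ, 0 < w a) →
        ∀ s : List Γ, s ≠ [] →
          ∃ (V : Type) (instV : Fintype V) (G : SLP V Γ),
            Fintype.card V ≤ c * s.length ∧
            (∀ A : V, (G.rhs A).length ≤ 10) ∧
            G.Contracting w ∧
            (∀ k : ℕ, 1 ≤ k → k ≤ s.length → G.defines (s.take k)) := by
  refine ⟨553, fun Γ _ w hw s hs => ?_⟩
  obtain ⟨R, hR, hc, hD⟩ := ContractingSLP.exists_prefix_rules w s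
  have hpos : 1 ≤ s.length := List.length_pos_iff.2 hs
  obtain ⟨V, hV, G, hcard, hlen, hcon, hdef⟩ := ContractingSLP.exists_slp_of_splits hw
    (ContractingSLP.factors R)
    (List.ne_nil_of_mem (ContractingSLP.mem_factors_of_derives (hD 1 le_rfl hpos))) 5
    fun x hx => hR.splits_five hx
  rw [ContractingSLP.length_factors] at hcard
  exact ⟨V, hV, G, hcard.trans hc, fun A => (hlen A).trans (by norm_num), hcon,
    fun k hk hks => hdef _ (ContractingSLP.mem_factors_of_derives (hD k hk hks))⟩
end
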